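/- arXiv:1312.7781 — 6 statements merged into one kernel-verified Lean document; each statement's English description precedes it below -/
import Mathlib

section
/- Let w be an isometry of E = ℝⁿ, let μ be the unique vector of minimal norm in the affine subspace Mov(w) ⊆ V, and define the min-set Min(w) = { x ∈ E : w(x) − x = μ }. Then Min(w) is a nonempty affine subspace of E. -/
open scoped RealInnerProductSpace

noncomputable section

/-- `n`-dimensional euclidean space `E = ℝⁿ` (also used as the vector space `V` of
translations). -/
abbrev Euc (n : ℕ) := EuclideanSpace ℝ (Fin n)

/-- An isometry of `E`: a surjective distance-preserving map of `E` to itself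
(such a map is automatically an affine bijection). -/
abbrev Iso (n : ℕ) := Euc n ≃ᵢ Euc n

/-- The move-set `Mov(w) = { w(x) - x : x ∈ E } ⊆ V`. -/
def MovSet (n : ℕ) (w : Iso n) : Set (Euc n) := {v | ∃ x, w x - x = v}

/-- The fix-set `Fix(w) = { x ∈ E : w(x) = x }`. -/
def FixSet (n : ℕ) (w : Iso n) : Set (Euc n) := {x | w x = x}

/-- A reflection: a nontrivial isometry fixing pointwise an affine hyperplane,
i.e. a nonempty affine subspace of codimension one. -/
def IsReflection (n : ℕ) (r : Iso n) : Prop :=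
  r ≠ 1 ∧ ∃ H : AffineSubspace ℝ (Euc n), (H : Set (Euc n)).Nonempty ∧
    Module.finrank ℝ H.direction + 1 = n ∧ ∀ x ∈ H, r x = x

/-- The reflection length `ℓ(w)`: the least `k` such that `w` is a product of `k`
reflections. -/
def reflLen (n : ℕ) (w : Iso n) : ℕ :=
  sInf {k | ∃ l : List (Iso n), l.length = k ∧ (∀ r ∈ l, IsReflection n r) ∧ l.prod = w}

/-- `u` lies in the interval `[1, w]`:  `ℓ(u) + ℓ(u⁻¹w) = ℓ(w)`. -/
def inInterval (n : ℕ) (w u : Iso n) : Prop :=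
  reflLen n u + reflLen n (u⁻¹ * w) = reflLen n w

/-- The betweenness partial order on the interval `[1, w]`:
`u ≤ v` iff `ℓ(u) + ℓ(u⁻¹v) + ℓ(v⁻¹w) = ℓ(w)`. -/
def intervalLE (n : ℕ) (w u v : Iso n) : Prop :=
  reflLen n u + reflLen n (u⁻¹ * v) + reflLen n (v⁻¹ * w) = reflLen n w

/-- The set of directions `Dir(S) = { m - m' : m, m' ∈ S }` of a subset `S`. -/
def dirSet (n : ℕ) (S : Set (Euc n)) : Set (Euc n) := {d | ∃ m ∈ S, ∃ m' ∈ S, d = m - m'}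

/-- `α` is a root of the reflection `r`: a nonzero vector orthogonal to the
direction space of the fixed hyperplane of `r`. -/
def IsRoot (n : ℕ) (r : Iso n) (α : Euc n) : Prop :=
  α ≠ 0 ∧ ∀ x y : Euc n, r x = x → r y = y → ⟪α, y - x⟫ = 0

/-- If `μ` is the unique vector of minimal norm in `Mov(w)`, then the
min-set `Min(w) = { x ∈ E : w(x) − x = μ }` is a nonempty affine subspace of `E`. -/
theorem minSet_nonempty_affine (n : ℕ) (w : Iso n) (μ : Euc n)
    (hμ : μ ∈ MovSet n w) (hmin : ∀ v ∈ MovSet n w, ‖μ‖ ≤ ‖v‖) :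
    {x : Euc n | w x - x = μ}.Nonempty ∧
    ∃ A : AffineSubspace ℝ (Euc n), (A : Set (Euc n)) = {x : Euc n | w x - x = μ} := by
  refine ⟨hμ, (affineSpan ℝ {μ}).comap
    (w.toRealAffineIsometryEquiv.toAffineEquiv.toAffineMap - AffineMap.id ℝ (Euc n)), ?_⟩
  ext x
  simp
end
end

section
/- (Scherk's theorem, elliptic case) Let w be an elliptic isometry of E = ℝⁿ whose move-set Mov(w) is a linear subspace of dimension k. Then the reflection length of w equals k, i.e. w is a product of k reflections and of no fewer. -/
open scoped RealInnerProductSpace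

noncomputable section

/-- The displacements of a reflection all lie on one line. -/
theorem IsReflection.exists_submodule_sub_mem {n : ℕ} {r : Iso n} (hr : IsReflection n r) :
    ∃ S : Submodule ℝ (Euc n), Module.finrank ℝ S ≤ 1 ∧ ∀ x, r x - x ∈ S := by
  obtain ⟨-, H, ⟨p, hp⟩, hdim, hfix⟩ := hr
  have hrp := hfix p hp
  set L : Euc n →ₗ[ℝ] Euc n :=
    r.toRealAffineIsometryEquiv.linearIsometryEquiv.toLinearEquiv.toLinearMap
  have hL : ∀ x, L (x - p) = r x - p := fun x => by
    simpa [L, hrp] using r.toRealAffineIsometryEquiv.map_vsub x p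
  refine ⟨(L - LinearMap.id).range, ?_, fun x => LinearMap.mem_range.mpr ⟨x - p, ?_⟩⟩
  · have hker : H.direction ≤ (L - LinearMap.id).ker := fun v hv => by
      have hv' := hfix _ (AffineSubspace.vadd_mem_of_mem_direction hv hp)
      have hLv := hL (v +ᵥ p)
      rw [hv'] at hLv
      simpa [sub_eq_zero] using hLv
    have hle := Submodule.finrank_mono hker
    have hrank := (L - LinearMap.id).finrank_range_add_finrank_ker
    rw [finrank_euclideanSpace_fin] at hrank
    omega
  · simp [hL]

/-- The displacements of a product of reflections span a subspace of dimension at most the number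
of factors. -/
theorem exists_submodule_prod_sub_mem {n : ℕ} (l : List (Iso n))
    (hl : ∀ r ∈ l, IsReflection n r) :
    ∃ S : Submodule ℝ (Euc n), Module.finrank ℝ S ≤ l.length ∧ ∀ x, l.prod x - x ∈ S := by
  induction l with
  | nil => exact ⟨⊥, by simp, fun x => by simp⟩
  | cons r l ih =>
    obtain ⟨S, hS, hmem⟩ := ih fun q hq => hl q (List.mem_cons_of_mem _ hq)
    obtain ⟨T, hT, hmemT⟩ := (hl r List.mem_cons_self).exists_submodule_sub_mem
    refine ⟨T ⊔ S, ?_, fun x => ?_⟩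
    · have := Submodule.finrank_add_le_finrank_add_finrank T S
      rw [List.length_cons]
      omega
    · rw [List.prod_cons, IsometryEquiv.mul_apply, ← sub_add_sub_cancel _ (l.prod x) x]
      exact Submodule.add_mem_sup (hmemT _) (hmem x)

/-- The linear isometries acting on `E` with the point `p` as origin. -/
def linearIsometryAt {n : ℕ} (p : Euc n) : (Euc n ≃ₗᵢ[ℝ] Euc n) →* Iso n where
  toFun φ := ((IsometryEquiv.subRight p).trans φ.toIsometryEquiv).trans (IsometryEquiv.addRight p)
  map_one' := by ext1 x; simp
  map_mul' φ ψ := by ext1 x; simp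

@[simp]
theorem linearIsometryAt_apply {n : ℕ} (p : Euc n) (φ : Euc n ≃ₗᵢ[ℝ] Euc n) (x : Euc n) :
    linearIsometryAt p φ x = φ (x - p) + p := rfl

theorem exists_linearIsometryAt_eq {n : ℕ} {w : Iso n} {p : Euc n} (hp : w p = p) :
    ∃ φ, linearIsometryAt p φ = w := by
  refine ⟨w.toRealAffineIsometryEquiv.linearIsometryEquiv, ?_⟩
  ext1 x
  have := w.toRealAffineIsometryEquiv.map_vsub x p
  simp_all

theorem isReflection_linearIsometryAt_reflection {n : ℕ} (p : Euc n) {v : Euc n} (hv : v ≠ 0) :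
    IsReflection n (linearIsometryAt p (ℝ ∙ v)ᗮ.reflection) := by
  refine ⟨fun h => hv ?_, AffineSubspace.mk' p (ℝ ∙ v)ᗮ, ⟨p, AffineSubspace.self_mem_mk' _ _⟩,
    ?_, fun x hx => ?_⟩
  · have h' := DFunLike.congr_fun h (v + p)
    rw [linearIsometryAt_apply, add_sub_cancel_right,
      Submodule.reflection_orthogonalComplement_singleton_eq_neg] at h'
    have := IsAddTorsionFree.of_isTorsionFree ℝ (Euc n)
    exact self_eq_neg.mp (by simpa using h'.symm)
  · have h := (ℝ ∙ v).finrank_add_finrank_orthogonal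
    rw [finrank_span_singleton hv, finrank_euclideanSpace_fin] at h
    rw [AffineSubspace.direction_mk']
    omega
  · rw [AffineSubspace.mem_mk', vsub_eq_sub] at hx
    rw [linearIsometryAt_apply, Submodule.reflection_mem_subspace_eq_self hx, sub_add_cancel]

theorem exists_reflections_prod_eq {n : ℕ} (p : Euc n) (l : List (Euc n)) :
    ∃ m : List (Iso n), (∀ r ∈ m, IsReflection n r) ∧ m.length ≤ l.length ∧
      m.prod = linearIsometryAt p (l.map fun v => (ℝ ∙ v)ᗮ.reflection).prod := by
  induction l with
  | nil => exact ⟨[], by simp⟩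
  | cons v l ih =>
    obtain ⟨m, hm, hlen, hprod⟩ := ih
    by_cases hv : v = 0
    · refine ⟨m, hm, by simp; omega, ?_⟩
      have h1 : (ℝ ∙ v)ᗮ.reflection = 1 := by
        ext1 x
        exact Submodule.reflection_mem_subspace_eq_self (by simp [hv])
      rw [List.map_cons, List.prod_cons, h1, one_mul, hprod]
    · refine ⟨linearIsometryAt p (ℝ ∙ v)ᗮ.reflection :: m, ?_, by simpa using hlen, ?_⟩
      · simpa using ⟨isReflection_linearIsometryAt_reflection p hv, hm⟩
      · rw [List.map_cons, List.prod_cons, List.prod_cons, map_mul, hprod]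

/-- A linear isometry based at `p` is a product of at most as many reflections as the dimension of
any subspace containing its displacements. -/
theorem exists_reflections_prod_eq_linearIsometryAt {n : ℕ} (p : Euc n)
    (φ : Euc n ≃ₗᵢ[ℝ] Euc n) (U : Submodule ℝ (Euc n)) (hU : ∀ x, φ x - x ∈ U) :
    ∃ m : List (Iso n), (∀ r ∈ m, IsReflection n r) ∧ m.length ≤ Module.finrank ℝ U ∧
      m.prod = linearIsometryAt p φ := by
  set f : Euc n →L[ℝ] Euc n := ContinuousLinearMap.id ℝ (Euc n) - φ with hf
  have hrange : f.toLinearMap.range ≤ U := by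
    rintro _ ⟨x, rfl⟩
    simpa [hf] using U.neg_mem (hU x)
  have hker : Module.finrank ℝ f.kerᗮ ≤ Module.finrank ℝ U := by
    have h1 := Submodule.finrank_mono hrange
    have h2 := f.toLinearMap.finrank_range_add_finrank_ker
    have h3 := f.ker.finrank_add_finrank_orthogonal
    omega
  obtain ⟨l, hl, hφ⟩ := φ.reflections_generate_dim_aux hker
  obtain ⟨m, hm, hlen, hprod⟩ := exists_reflections_prod_eq p l
  exact ⟨m, hm, hlen.trans hl, by rw [hprod, hφ]⟩

/-- Scherk's theorem, elliptic case: if `w` is elliptic with move-set a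
linear subspace `U` of dimension `k`, then `w` is a product of `k` reflections and of
no fewer; i.e. `ℓ(w) = k`. -/
theorem scherk_elliptic (n k : ℕ) (w : Iso n) (U : Submodule ℝ (Euc n))
    (hell : (0 : Euc n) ∈ MovSet n w)
    (hU : (U : Set (Euc n)) = MovSet n w)
    (hk : Module.finrank ℝ U = k) :
    (∃ l : List (Iso n), (∀ r ∈ l, IsReflection n r) ∧ l.prod = w ∧ l.length = k) ∧
    (∀ l : List (Iso n), (∀ r ∈ l, IsReflection n r) → l.prod = w → k ≤ l.length) := by
  have hmov : ∀ x, w x - x ∈ U := fun x => by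
    rw [← SetLike.mem_coe, hU]
    exact ⟨x, rfl⟩
  have lower : ∀ l : List (Iso n), (∀ r ∈ l, IsReflection n r) → l.prod = w → k ≤ l.length := by
    rintro l hl rfl
    obtain ⟨S, hS, hmem⟩ := exists_submodule_prod_sub_mem l hl
    have hUS : U ≤ S := fun v hv => by
      rw [← SetLike.mem_coe, hU] at hv
      obtain ⟨x, rfl⟩ := hv
      exact hmem x
    exact hk ▸ (Submodule.finrank_mono hUS).trans hS
  refine ⟨?_, lower⟩
  obtain ⟨p, hp⟩ := hell
  obtain ⟨φ, rfl⟩ := exists_linearIsometryAt_eq (sub_eq_zero.mp hp)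
  obtain ⟨m, hm, hlen, hprod⟩ := exists_reflections_prod_eq_linearIsometryAt p φ U fun x => by
    simpa using hmov (x + p)
  exact ⟨m, hm, hprod, (hk ▸ hlen).antisymm (lower m hm hprod)⟩
end
end

section
/- (Scherk's theorem, hyperbolic case) Let w be a hyperbolic isometry of E = ℝⁿ whose move-set Mov(w) is an affine subspace of dimension k (i.e. its space of directions has dimension k). Then the reflection length of w equals k + 2. -/
open scoped RealInnerProductSpace

noncomputable section

/-- The reflection of `ℝⁿ` in the hyperplane through `p` orthogonal to `a`
(the identity when `a = 0`). -/
def hyperplaneReflection (n : ℕ) (a p : Euc n) : Iso n :=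
  ((IsometryEquiv.subRight p).trans (ℝ ∙ a)ᗮ.reflection.toIsometryEquiv).trans
    (IsometryEquiv.addRight p)

lemma hyperplaneReflection_apply (n : ℕ) (a p x : Euc n) :
    hyperplaneReflection n a p x = (ℝ ∙ a)ᗮ.reflection (x - p) + p := rfl

lemma hyperplaneReflection_sub_self_mem_span (n : ℕ) (a p x : Euc n) :
    hyperplaneReflection n a p x - x ∈ ℝ ∙ a := by
  rw [hyperplaneReflection_apply, Submodule.reflection_orthogonal_apply,
    Submodule.reflection_apply]
  have h : -(2 • (ℝ ∙ a).starProjection (x - p) - (x - p)) + p - x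
      = -(2 • (ℝ ∙ a).starProjection (x - p)) := by abel
  rw [h]
  exact neg_mem (nsmul_mem (Submodule.starProjection_apply_mem _ _) 2)

lemma hyperplaneReflection_involutive (n : ℕ) (a p : Euc n) :
    hyperplaneReflection n a p * hyperplaneReflection n a p = 1 := by
  ext1 x
  change hyperplaneReflection n a p (hyperplaneReflection n a p x) = x
  simp [hyperplaneReflection_apply]

lemma isReflection_hyperplaneReflection (n : ℕ) {a : Euc n} (ha : a ≠ 0) (p : Euc n) :
    IsReflection n (hyperplaneReflection n a p) := by
  refine ⟨fun h => ha ?_, AffineSubspace.mk' p (ℝ ∙ a)ᗮ, ⟨p, AffineSubspace.self_mem_mk' _ _⟩,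
    ?_, fun x hx => ?_⟩
  · have h1 : hyperplaneReflection n a p (a + p) = a + p := by rw [h]; rfl
    rw [hyperplaneReflection_apply, add_sub_cancel_right,
      Submodule.reflection_orthogonalComplement_singleton_eq_neg] at h1
    have h2 : (2 : ℝ) • a = 0 := by
      rw [two_smul, ← neg_eq_iff_add_eq_zero]
      exact add_right_cancel h1
    exact (smul_eq_zero.mp h2).resolve_left two_ne_zero
  · rw [AffineSubspace.direction_mk']
    have h1 := (ℝ ∙ a).finrank_add_finrank_orthogonal
    rw [finrank_span_singleton ha, finrank_euclideanSpace_fin] at h1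
    omega
  · rw [AffineSubspace.mem_mk', vsub_eq_sub] at hx
    rw [hyperplaneReflection_apply, Submodule.reflection_mem_subspace_eq_self hx, sub_add_cancel]

/-- A reflection moves points along a single direction `a`, and fixes the hyperplane through
some point `p` orthogonal to `a`. -/
lemma IsReflection.exists_root {n : ℕ} {r : Iso n} (hr : IsReflection n r) :
    ∃ a p : Euc n, (∀ x, r x - x ∈ ℝ ∙ a) ∧ ∀ x, ⟪a, x - p⟫ = 0 → r x = x := by
  obtain ⟨-, H, ⟨p, hp⟩, hdim, hfix⟩ := hr
  have h1 := H.direction.finrank_add_finrank_orthogonal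
  rw [finrank_euclideanSpace_fin] at h1
  obtain ⟨a, -, ha⟩ := finrank_eq_one_iff'.mp (show Module.finrank ℝ H.directionᗮ = 1 by omega)
  have hspan : H.directionᗮ = ℝ ∙ (a : Euc n) := by
    refine le_antisymm (fun v hv => ?_) ?_
    · obtain ⟨c, hc⟩ := ha ⟨v, hv⟩
      exact Submodule.mem_span_singleton.mpr ⟨c, congrArg Subtype.val hc⟩
    · rw [Submodule.span_singleton_le_iff_mem]
      exact a.2
  refine ⟨a, p, fun x => ?_, fun x hx => hfix x ?_⟩
  · rw [← hspan, Submodule.mem_orthogonal]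
    intro h hh
    have e1 : ‖r x - p‖ = ‖x - p‖ := by
      have := r.isometry.dist_eq x p
      rwa [hfix p hp, dist_eq_norm, dist_eq_norm] at this
    have e2 : ‖(r x - p) - h‖ = ‖(x - p) - h‖ := by
      have hq : h + p ∈ H := AffineSubspace.vadd_mem_of_mem_direction hh hp
      have := r.isometry.dist_eq x (h + p)
      rwa [hfix _ hq, dist_eq_norm, dist_eq_norm, sub_add_eq_sub_sub_swap,
        sub_add_eq_sub_sub_swap] at this
    have e3 := norm_sub_sq_real (r x - p) h
    have e4 := norm_sub_sq_real (x - p) h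
    rw [e2, e1] at e3
    have e5 : ⟪h, r x - x⟫ = ⟪r x - p, h⟫ - ⟪x - p, h⟫ := by
      rw [← inner_sub_left, real_inner_comm, sub_sub_sub_cancel_right]
    linarith
  · have hx' : x - p ∈ H.direction := by
      rw [← H.direction.orthogonal_orthogonal, hspan]
      exact Submodule.mem_orthogonal_singleton_iff_inner_right.mpr hx
    simpa using AffineSubspace.vadd_mem_of_mem_direction hx' hp

/-- A product of `m` reflections moves points along a subspace `S` of dimension at most `m`,
and fixes a translate of `Sᗮ` pointwise if the dimension of `S` is exactly `m`. -/
lemma exists_submodule_of_prod_reflections {n : ℕ} (l : List (Iso n))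
    (hl : ∀ r ∈ l, IsReflection n r) :
    ∃ S : Submodule ℝ (Euc n), (∀ x, l.prod x - x ∈ S) ∧ Module.finrank ℝ S ≤ l.length ∧
      (Module.finrank ℝ S < l.length ∨ ∃ p, ∀ x, x - p ∈ Sᗮ → l.prod x = x) := by
  induction l with
  | nil => exact ⟨⊥, by simp, by simp, Or.inr ⟨0, by simp⟩⟩
  | cons r l ih =>
    obtain ⟨S, hS, hdim, hfix⟩ := ih fun s hs => hl s (List.mem_cons_of_mem _ hs)
    obtain ⟨a, q, hrS, hrfix⟩ := (hl r List.mem_cons_self).exists_root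
    have hprod : ∀ x, (r :: l).prod x = r (l.prod x) := fun x => by
      rw [List.prod_cons]; rfl
    have hle : Module.finrank ℝ ↥(S ⊔ ℝ ∙ a) ≤ Module.finrank ℝ S + 1 :=
      (Submodule.finrank_add_le_finrank_add_finrank _ _).trans
        (Nat.add_le_add_left ((finrank_span_le_card _).trans (by simp)) _)
    refine ⟨S ⊔ ℝ ∙ a, fun x => ?_, hle.trans (by simpa using hdim), ?_⟩
    · rw [hprod, ← sub_add_sub_cancel (r (l.prod x)) (l.prod x) x]
      exact add_mem (Submodule.mem_sup_right (hrS _)) (Submodule.mem_sup_left (hS x))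
    · rw [List.length_cons]
      rcases hfix with hlt | ⟨p, hp⟩
      · exact Or.inl (by omega)
      by_cases ha : a ∈ S
      · refine Or.inl ?_
        rw [sup_eq_left.mpr ((Submodule.span_singleton_le_iff_mem _ _).mpr ha)]
        omega
      · right
        obtain ⟨y, hy, hay⟩ : ∃ y ∈ Sᗮ, ⟪a, y⟫ ≠ 0 := by
          by_contra! h
          apply ha
          rw [← S.orthogonal_orthogonal, Submodule.mem_orthogonal']
          exact h
        refine ⟨p + (⟪a, q - p⟫ / ⟪a, y⟫) • y, fun x hx => ?_⟩
        rw [← Submodule.inf_orthogonal, Submodule.mem_inf,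
          Submodule.mem_orthogonal_singleton_iff_inner_right] at hx
        have hx1 : l.prod x = x := by
          apply hp
          have := add_mem hx.1 (Submodule.smul_mem _ (⟪a, q - p⟫ / ⟪a, y⟫) hy)
          rwa [sub_add_eq_sub_sub, sub_add_cancel] at this
        rw [hprod, hx1]
        apply hrfix
        have h2 := hx.2
        rw [sub_add_eq_sub_sub, inner_sub_right, inner_smul_right, div_mul_cancel₀ _ hay,
          ← inner_sub_right, sub_sub_sub_cancel_right] at h2
        exact h2

/-- The linear part of an isometry of `ℝⁿ`. -/
lemma exists_linearIsometryEquiv {n : ℕ} (w : Iso n) :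
    ∃ φ : Euc n ≃ₗᵢ[ℝ] Euc n, ∀ x y, w x - w y = φ (x - y) :=
  ⟨w.toRealAffineIsometryEquiv.linearIsometryEquiv, fun x y =>
    (w.toRealAffineIsometryEquiv.map_vsub x y).symm⟩

/-- A product of linear reflections, recentred at `p`, is a product of at most as many
reflections. -/
lemma exists_reflections_of_linear {n : ℕ} (p : Euc n) (l : List (Euc n)) :
    ∃ L : List (Iso n), (∀ r ∈ L, IsReflection n r) ∧ L.length ≤ l.length ∧
      ∀ x, L.prod x = (l.map fun v => (ℝ ∙ v)ᗮ.reflection).prod (x - p) + p := by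
  induction l with
  | nil => exact ⟨[], by simp, by simp, by simp⟩
  | cons v l ih =>
    obtain ⟨L, hL, hlen, hprod⟩ := ih
    by_cases hv : v = 0
    · refine ⟨L, hL, hlen.trans (by simp), fun x => ?_⟩
      rw [hprod, List.map_cons, List.prod_cons, LinearIsometryEquiv.coe_mul, Function.comp_apply,
        Submodule.reflection_mem_subspace_eq_self]
      simp [hv]
    · refine ⟨hyperplaneReflection n v p :: L, ?_, by simpa using hlen, fun x => ?_⟩
      · simpa using ⟨isReflection_hyperplaneReflection n hv p, hL⟩
      · rw [List.map_cons, List.prod_cons, List.prod_cons, LinearIsometryEquiv.coe_mul,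
          Function.comp_apply]
        change hyperplaneReflection n v p (L.prod x) = _
        rw [hprod, hyperplaneReflection_apply, add_sub_cancel_right]

/-- An isometry with a fixed point moving points along a subspace `S` is a product of at most
`dim S` reflections. -/
lemma exists_reflections_of_fixed {n : ℕ} (u : Iso n) {p : Euc n} (hp : u p = p)
    (S : Submodule ℝ (Euc n)) (hS : ∀ x, u x - x ∈ S) :
    ∃ L : List (Iso n), (∀ r ∈ L, IsReflection n r) ∧ L.prod = u ∧
      L.length ≤ Module.finrank ℝ S := by
  obtain ⟨φ, hφ⟩ := exists_linearIsometryEquiv u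
  obtain ⟨l, hlen, hl⟩ := φ.reflections_generate_dim_aux le_rfl
  obtain ⟨L, hL, hLlen, hprod⟩ := exists_reflections_of_linear p l
  refine ⟨L, hL, ?_, hLlen.trans (hlen.trans ?_)⟩
  · ext1 x
    rw [hprod, ← hl, ← hφ, hp, sub_add_cancel]
  · set f : Euc n →ₗ[ℝ] Euc n :=
      LinearMap.id - (φ.toLinearEquiv : Euc n →ₗ[ℝ] Euc n)
    have h1 := (LinearMap.ker f).finrank_add_finrank_orthogonal
    have h2 := f.finrank_range_add_finrank_ker
    have h3 : LinearMap.range f ≤ S := by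
      rintro _ ⟨v, rfl⟩
      have h4 := neg_mem (hS (v + p))
      have h5 := hφ (v + p) p
      rw [hp, add_sub_cancel_right] at h5
      have h6 : f v = -(u (v + p) - (v + p)) := by
        change v - φ v = _
        rw [← h5]; abel
      rwa [h6]
    have h4 := Submodule.finrank_mono h3
    change Module.finrank ℝ (LinearMap.ker f)ᗮ ≤ _
    omega

/-- Scherk's theorem, hyperbolic case: if `w` is hyperbolic and its
move-set is an affine subspace of dimension `k` (its space of directions has
dimension `k`), then the reflection length of `w` is `k + 2`. -/
theorem scherk_hyperbolic (n k : ℕ) (w : Iso n) (U : Submodule ℝ (Euc n))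
    (hhyp : (0 : Euc n) ∉ MovSet n w)
    (hU : (U : Set (Euc n)) = dirSet n (MovSet n w))
    (hk : Module.finrank ℝ U = k) :
    (∃ l : List (Iso n), (∀ r ∈ l, IsReflection n r) ∧ l.prod = w ∧ l.length = k + 2) ∧
    (∀ l : List (Iso n), (∀ r ∈ l, IsReflection n r) → l.prod = w → k + 2 ≤ l.length) := by
  obtain ⟨φ, hφ⟩ := exists_linearIsometryEquiv w
  have hdiff : ∀ x y, (w x - x) - (w y - y) ∈ U := fun x y => by
    rw [← SetLike.mem_coe, hU]
    exact ⟨_, ⟨x, rfl⟩, _, ⟨y, rfl⟩, rfl⟩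
  have hlower : ∀ l : List (Iso n), (∀ r ∈ l, IsReflection n r) → l.prod = w →
      k + 2 ≤ l.length := by
    intro l hl hw
    obtain ⟨S, hS, -, hfix⟩ := exists_submodule_of_prod_reflections l hl
    rw [hw] at hS hfix
    have hUS : U < S := by
      refine lt_of_le_of_ne (fun d hd => ?_) fun h => ?_
      · rw [← SetLike.mem_coe, hU] at hd
        obtain ⟨_, ⟨x, rfl⟩, _, ⟨y, rfl⟩, rfl⟩ := hd
        exact sub_mem (hS x) (hS y)
      · have h0 := hS 0
        rw [← h, ← SetLike.mem_coe, hU] at h0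
        obtain ⟨_, ⟨x, rfl⟩, _, ⟨y, rfl⟩, hxy⟩ := h0
        refine hhyp ⟨y - x, ?_⟩
        have h1 := hφ (y - x) 0
        have h2 := hφ y x
        rw [sub_zero, ← h2] at h1
        rw [sub_zero] at hxy
        rw [sub_eq_iff_eq_add.mp h1, hxy]
        abel
    have hlt := Submodule.finrank_lt_finrank_of_lt hUS
    rcases hfix with h | ⟨p, hp⟩
    · omega
    · exact absurd ⟨p, by rw [hp p (by simp), sub_self]⟩ hhyp
  refine ⟨?_, hlower⟩
  set a := w 0 - 0 with ha
  have ha0 : a ≠ 0 := fun h => hhyp ⟨0, h⟩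
  set r := hyperplaneReflection n a ((2⁻¹ : ℝ) • a) with hr
  have hfix : (r * w) 0 = 0 := by
    change r (w 0) = 0
    have h1 : w 0 - (2⁻¹ : ℝ) • a = (2⁻¹ : ℝ) • a := by
      rw [← sub_zero (w 0), ← ha]; module
    rw [hr, hyperplaneReflection_apply, h1, map_smul,
      Submodule.reflection_orthogonalComplement_singleton_eq_neg, smul_neg, neg_add_cancel]
  obtain ⟨L, hL, hprod, hlen⟩ := exists_reflections_of_fixed (r * w) hfix (U ⊔ ℝ ∙ a) fun x => by
    have h1 : (r * w) x - x = (r (w x) - w x + a) + ((w x - x) - (w 0 - 0)) := by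
      change r (w x) - x = _
      rw [← ha]; abel
    rw [h1]
    exact add_mem (Submodule.mem_sup_right (add_mem
      (hyperplaneReflection_sub_self_mem_span n a _ _) (Submodule.mem_span_singleton_self a)))
      (Submodule.mem_sup_left (hdiff x 0))
  have hle : Module.finrank ℝ ↥(U ⊔ ℝ ∙ a) ≤ k + 1 := by
    have := Submodule.finrank_add_le_finrank_add_finrank U (ℝ ∙ a)
    rwa [hk, finrank_span_singleton ha0] at this
  have hmem : ∀ s ∈ r :: L, IsReflection n s := by
    simpa using ⟨isReflection_hyperplaneReflection n ha0 _, hL⟩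
  have hw : (r :: L).prod = w := by
    rw [List.prod_cons, hprod, ← mul_assoc, hr, hyperplaneReflection_involutive, one_mul]
  refine ⟨r :: L, hmem, hw, le_antisymm ?_ (hlower _ hmem hw)⟩
  rw [List.length_cons]
  omega
end
end

section
/- Let w be a hyperbolic isometry of E = ℝⁿ with reflection length ℓ(w) = k, write Mov(w) = U + μ in standard form (U = Dir(Mov(w)) a linear subspace of V and μ the unique vector of Mov(w) orthogonal to U), and let r be a reflection with root α. If α ∈ U, then the isometry rw is hyperbolic and ℓ(rw) = k − 1. -/
open scoped RealInnerProductSpace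

noncomputable section

open Submodule Module

/-- The direction space of the fix-set of the linear part of `w`. -/
def fixDir (n : ℕ) (w : Iso n) : Submodule ℝ (Euc n) :=
  (ContinuousLinearMap.id ℝ (Euc n) -
    (w.toRealLinearIsometryEquiv : Euc n →L[ℝ] Euc n)).ker

theorem mem_fixDir {n : ℕ} {w : Iso n} {x : Euc n} : x ∈ fixDir n w ↔ w x - w 0 = x := by
  rw [fixDir, LinearMap.mem_ker]
  simp [sub_eq_zero (a := x), eq_comm (a := x)]

theorem map_eq_linear_add {n : ℕ} (w : Iso n) (x p : Euc n) :
    w x = w.toRealLinearIsometryEquiv (x - p) + w p := by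
  rw [map_sub]
  simp

/-- The direction space of the move-set of `w`. -/
def moveDir (n : ℕ) (w : Iso n) : Submodule ℝ (Euc n) :=
  LinearMap.range (ContinuousLinearMap.id ℝ (Euc n) -
    (w.toRealLinearIsometryEquiv : Euc n →L[ℝ] Euc n)).toLinearMap

theorem mem_moveDir {n : ℕ} {w : Iso n} {v : Euc n} :
    v ∈ moveDir n w ↔ ∃ x, x - (w x - w 0) = v := by
  simp [moveDir]

theorem finrank_moveDir_add_fixDir (n : ℕ) (w : Iso n) :
    finrank ℝ (moveDir n w) + finrank ℝ (fixDir n w) = n := by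
  have h := LinearMap.finrank_range_add_finrank_ker (ContinuousLinearMap.id ℝ (Euc n) -
    (w.toRealLinearIsometryEquiv : Euc n →L[ℝ] Euc n)).toLinearMap
  rw [finrank_euclideanSpace_fin] at h
  exact h

theorem finrank_fixDir_orthogonal (n : ℕ) (w : Iso n) :
    finrank ℝ (fixDir n w)ᗮ = finrank ℝ (moveDir n w) := by
  have h := (fixDir n w).finrank_add_finrank_orthogonal
  rw [finrank_euclideanSpace_fin] at h
  have := finrank_moveDir_add_fixDir n w
  omega

theorem dirSet_movSet (n : ℕ) (w : Iso n) :
    dirSet n (MovSet n w) = (moveDir n w : Set (Euc n)) := by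
  ext d
  rw [SetLike.mem_coe, mem_moveDir]
  constructor
  · rintro ⟨_, ⟨x, rfl⟩, _, ⟨y, rfl⟩, rfl⟩
    refine ⟨y - x, ?_⟩
    rw [map_eq_linear_add w (y - x) 0, sub_zero, map_sub]
    simp only [IsometryEquiv.toRealLinearIsometryEquiv_apply]
    abel
  · rintro ⟨x, rfl⟩
    exact ⟨w 0 - 0, ⟨0, rfl⟩, w x - x, ⟨x, rfl⟩, by abel⟩

/-- The reflection with root `α` whose fixed hyperplane passes through `p`. -/
def reflAt (n : ℕ) (p α : Euc n) : Iso n :=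
  ((IsometryEquiv.addRight (-p)).trans (ℝ ∙ α)ᗮ.reflection.toIsometryEquiv).trans
    (IsometryEquiv.addRight p)

theorem reflAt_apply (n : ℕ) (p α x : Euc n) :
    reflAt n p α x = (ℝ ∙ α)ᗮ.reflection (x - p) + p := by
  simp [reflAt, sub_eq_add_neg]

theorem reflAt_mul_self (n : ℕ) (p α : Euc n) : reflAt n p α * reflAt n p α = 1 := by
  ext1 x
  rw [IsometryEquiv.mul_apply, reflAt_apply, reflAt_apply]
  simp

theorem reflAt_eq_self_iff {n : ℕ} {p α x : Euc n} :
    reflAt n p α x = x ↔ ⟪α, x - p⟫ = 0 := by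
  rw [reflAt_apply, ← eq_sub_iff_add_eq, reflection_eq_self_iff,
    mem_orthogonal_singleton_iff_inner_right]

theorem reflAt_sub_mem_span (n : ℕ) (p α x : Euc n) : reflAt n p α x - x ∈ ℝ ∙ α := by
  have h : reflAt n p α x - x = (ℝ ∙ α)ᗮ.reflection (x - p) - (x - p) := by
    rw [reflAt_apply]; abel
  rw [h, reflection_orthogonal_apply, Submodule.reflection_apply]
  have := (ℝ ∙ α).starProjection_apply_mem (x - p)
  have h2 : -(2 • (ℝ ∙ α).starProjection (x - p) - (x - p)) - (x - p) =
      -(2 • (ℝ ∙ α).starProjection (x - p)) := by abel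
  rw [h2]
  exact neg_mem (nsmul_mem this 2)

theorem isReflection_reflAt {n : ℕ} (p : Euc n) {α : Euc n} (hα : α ≠ 0) :
    IsReflection n (reflAt n p α) := by
  refine ⟨fun h => ?_, AffineSubspace.mk' p (ℝ ∙ α)ᗮ, ⟨p, AffineSubspace.self_mem_mk' _ _⟩, ?_, ?_⟩
  · have h1 : reflAt n p α (α + p) = α + p := by rw [h]; rfl
    rw [reflAt_eq_self_iff, add_sub_cancel_right, inner_self_eq_zero] at h1
    exact hα h1
  · rw [AffineSubspace.direction_mk']
    have h := (ℝ ∙ α).finrank_add_finrank_orthogonal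
    rw [finrank_euclideanSpace_fin, finrank_span_singleton hα] at h
    omega
  · intro x hx
    rw [AffineSubspace.mem_mk', vsub_eq_sub, mem_orthogonal_singleton_iff_inner_right] at hx
    exact reflAt_eq_self_iff.2 hx

theorem inner_sub_map_eq_zero {n : ℕ} (A : Euc n ≃ₗᵢ[ℝ] Euc n) {d : Euc n} (hd : A d = d)
    (x : Euc n) : ⟪x - A x, d⟫ = 0 := by
  have h := A.inner_map_map x d
  rw [hd] at h
  rw [inner_sub_left, h, sub_self]

theorem IsReflection.exists_eq_reflAt {n : ℕ} {r : Iso n} (hr : IsReflection n r) :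
    ∃ p α, α ≠ 0 ∧ r = reflAt n p α := by
  obtain ⟨hr1, H, ⟨p, hp⟩, hdim, hfix⟩ := hr
  obtain ⟨z, hz⟩ : ∃ z, r z ≠ z := by
    by_contra! h
    exact hr1 (IsometryEquiv.ext h)
  have hrp := hfix p hp
  set A := r.toRealLinearIsometryEquiv
  have hA (x : Euc n) : r x = A (x - p) + p := by rw [map_eq_linear_add r x p, hrp]
  have hAd (d : Euc n) (hd : d ∈ H.direction) : A d = d := by
    have h := hfix (d + p) (AffineSubspace.vadd_mem_of_mem_direction hd hp)
    rwa [hA, add_sub_cancel_right, add_left_inj] at h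
  have hAz : A (z - p) ≠ z - p := fun h => hz (by rw [hA, h, sub_add_cancel])
  have hα : (z - p) - A (z - p) ≠ 0 := sub_ne_zero.2 hAz.symm
  refine ⟨p, (z - p) - A (z - p), hα, ?_⟩
  set α := (z - p) - A (z - p)
  let S := LinearMap.eqLocus (A : Euc n →ₗ[ℝ] Euc n) ((ℝ ∙ α)ᗮ.reflection : Euc n →ₗ[ℝ] Euc n)
  have hmem (x : Euc n) : x ∈ S ↔ A x = (ℝ ∙ α)ᗮ.reflection x := LinearMap.mem_eqLocus
  have hlt : H.direction < S := by
    refine SetLike.lt_iff_le_and_exists.2 ⟨fun d hd => ?_, z - p, ?_, fun h => hAz (hAd _ h)⟩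
    · rw [hmem, hAd d hd, eq_comm, reflection_eq_self_iff, mem_orthogonal_singleton_iff_inner_right]
      exact inner_sub_map_eq_zero A (hAd d hd) _
    · rw [hmem, reflection_sub (A.norm_map _).symm]
  have htop : S = ⊤ := by
    apply eq_top_of_finrank_eq
    have h1 := finrank_lt_finrank_of_lt hlt
    have h2 := S.finrank_le
    rw [finrank_euclideanSpace_fin] at h2 ⊢
    omega
  ext1 x
  rw [hA, reflAt_apply, (hmem (x - p)).1 (htop ▸ mem_top)]

theorem IsRoot.eq_reflAt {n : ℕ} {r : Iso n} {α : Euc n} (hr : IsReflection n r)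
    (hroot : IsRoot n r α) : ∃ p, r = reflAt n p α := by
  obtain ⟨p, β, -, rfl⟩ := hr.exists_eq_reflAt
  obtain ⟨hα, h⟩ := hroot
  refine ⟨p, ?_⟩
  have hmem : α ∈ (ℝ ∙ β)ᗮᗮ := by
    rw [mem_orthogonal']
    intro d hd
    rw [mem_orthogonal_singleton_iff_inner_right] at hd
    have := h p (d + p) (by simp [reflAt_eq_self_iff]) (by simp [reflAt_eq_self_iff, hd])
    rwa [add_sub_cancel_right] at this
  rw [orthogonal_orthogonal, mem_span_singleton] at hmem
  obtain ⟨c, rfl⟩ := hmem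
  have hc : c ≠ 0 := by
    rintro rfl
    simp at hα
  ext1 x
  simp only [reflAt_apply, span_singleton_smul_eq (IsUnit.mk0 c hc)]

theorem exists_list_of_fixed_point {n : ℕ} {v : Iso n} {p : Euc n} (hp : v p = p) :
    ∃ l : List (Iso n), l.length ≤ finrank ℝ (moveDir n v) ∧
      (∀ r ∈ l, IsReflection n r) ∧ l.prod = v := by
  have hconj (l : List (Euc n)) : ∃ l' : List (Iso n), l'.length ≤ l.length ∧
      (∀ r ∈ l', IsReflection n r) ∧
      ∀ x, l'.prod x = (l.map fun v => (ℝ ∙ v)ᗮ.reflection).prod (x - p) + p := by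
    induction l with
    | nil => exact ⟨[], by simp⟩
    | cons a l ih =>
      obtain ⟨l', hlen, hrefl, hprod⟩ := ih
      by_cases ha : a = 0
      · refine ⟨l', by simp; omega, hrefl, fun x => ?_⟩
        rw [hprod, List.map_cons, List.prod_cons, LinearIsometryEquiv.coe_mul,
          Function.comp_apply, eq_comm, add_left_inj, reflection_eq_self_iff]
        simp [ha]
      · refine ⟨reflAt n p a :: l', by simpa using hlen, ?_, fun x => ?_⟩
        · simpa [isReflection_reflAt p ha] using hrefl
        · rw [List.prod_cons, IsometryEquiv.mul_apply, hprod, reflAt_apply]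
          simp
  obtain ⟨l, hlen, hl⟩ := v.toRealLinearIsometryEquiv.reflections_generate_dim_aux
    (finrank_fixDir_orthogonal n v).le
  obtain ⟨l', hlen', hrefl, hprod⟩ := hconj l
  refine ⟨l', hlen'.trans hlen, hrefl, IsometryEquiv.ext fun x => ?_⟩
  rw [hprod, ← hl, map_eq_linear_add v x p, hp]

theorem moveDir_reflAt_mul_le (n : ℕ) (p α : Euc n) (v : Iso n) :
    moveDir n (reflAt n p α * v) ≤ moveDir n v ⊔ ℝ ∙ α := by
  intro d hd
  obtain ⟨x, rfl⟩ := mem_moveDir.1 hd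
  have h : x - ((reflAt n p α * v) x - (reflAt n p α * v) 0) =
      (x - (v x - v 0)) +
        ((reflAt n p α (v 0) - v 0) - (reflAt n p α (v x) - v x)) := by
    simp only [IsometryEquiv.mul_apply]
    abel
  rw [h]
  exact add_mem_sup (mem_moveDir.2 ⟨x, rfl⟩)
    (sub_mem (reflAt_sub_mem_span n p α _) (reflAt_sub_mem_span n p α _))

theorem finrank_moveDir_reflAt_mul_le (n : ℕ) (p α : Euc n) (v : Iso n) :
    finrank ℝ (moveDir n (reflAt n p α * v)) ≤ finrank ℝ (moveDir n v) + 1 := by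
  have h1 := finrank_mono (moveDir_reflAt_mul_le n p α v)
  have h2 := finrank_add_le_finrank_add_finrank (moveDir n v) (ℝ ∙ α)
  have h3 : finrank ℝ (ℝ ∙ α) ≤ 1 := (finrank_span_le_card {α}).trans (by simp)
  omega

theorem exists_list_length_le (n : ℕ) (v : Iso n) :
    ∃ l : List (Iso n), l.length ≤ finrank ℝ (moveDir n v) + 2 ∧
      (∀ r ∈ l, IsReflection n r) ∧ l.prod = v := by
  by_cases h0 : v 0 = 0
  · obtain ⟨l, hlen, hl⟩ := exists_list_of_fixed_point h0
    exact ⟨l, by omega, hl⟩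
  set r := reflAt n ((2⁻¹ : ℝ) • v 0) (v 0) with hr
  have hfix : (r * v) 0 = 0 := by
    have h : v 0 - (2⁻¹ : ℝ) • v 0 = (2⁻¹ : ℝ) • v 0 := by module
    rw [IsometryEquiv.mul_apply, hr, reflAt_apply, h, map_smul,
      reflection_orthogonalComplement_singleton_eq_neg, smul_neg, neg_add_cancel]
  obtain ⟨l, hlen, hrefl, hprod⟩ := exists_list_of_fixed_point hfix
  have hrank : finrank ℝ (moveDir n (r * v)) ≤ finrank ℝ (moveDir n v) + 1 :=
    finrank_moveDir_reflAt_mul_le n _ _ v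
  refine ⟨r :: l, ?_, ?_, ?_⟩
  · rw [List.length_cons]
    omega
  · simpa [hr, isReflection_reflAt _ h0] using hrefl
  · rw [List.prod_cons, hprod, ← mul_assoc, reflAt_mul_self, one_mul]

theorem finrank_moveDir_reflAt_mul_lt {n : ℕ} (p : Euc n) {α : Euc n} (hα : α ≠ 0) {v : Iso n}
    (hmem : α ∈ moveDir n v) :
    finrank ℝ (moveDir n (reflAt n p α * v)) < finrank ℝ (moveDir n v) := by
  obtain ⟨y, rfl⟩ := mem_moveDir.1 hmem
  set A := v.toRealLinearIsometryEquiv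
  have hAdef (x : Euc n) : v x - v 0 = A x := (v.toRealLinearIsometryEquiv_apply x).symm
  rw [hAdef] at *
  have hfix (x : Euc n) : x ∈ fixDir n (reflAt n p (y - A y) * v) ↔
      (ℝ ∙ (y - A y))ᗮ.reflection (A x) = x := by
    rw [mem_fixDir, IsometryEquiv.mul_apply, IsometryEquiv.mul_apply, reflAt_apply, reflAt_apply,
      add_sub_add_right_eq_sub, ← map_sub, sub_sub_sub_cancel_right, hAdef]
  have hlt : fixDir n v < fixDir n (reflAt n p (y - A y) * v) := by
    refine SetLike.lt_iff_le_and_exists.2 ⟨fun d hd => ?_, y, ?_, fun h => hα ?_⟩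
    · rw [mem_fixDir, hAdef] at hd
      rw [hfix, hd, reflection_eq_self_iff, mem_orthogonal_singleton_iff_inner_right]
      exact inner_sub_map_eq_zero A hd y
    · have h := reflection_sub (A.norm_map y).symm
      rw [hfix]
      exact (congrArg _ h.symm).trans (reflection_reflection _ y)
    · rw [mem_fixDir, hAdef] at h
      rw [h, sub_self]
  have h := finrank_lt_finrank_of_lt hlt
  have h1 := finrank_moveDir_add_fixDir n v
  have h2 := finrank_moveDir_add_fixDir n (reflAt n p (y - A y) * v)
  omega

theorem exists_inner_eq_of_linearIndependent {n : ℕ} {ι : Type*} {f : ι → Euc n}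
    (hf : LinearIndependent ℝ f) (c : ι → ℝ) : ∃ x : Euc n, ∀ i, ⟪f i, x⟫ = c i := by
  obtain ⟨φ, hφ⟩ := LinearMap.exists_extend ((Basis.span hf).constr ℝ c)
  refine ⟨(InnerProductSpace.toDual ℝ (Euc n)).symm (LinearMap.toContinuousLinearMap φ),
    fun i => ?_⟩
  rw [real_inner_comm, InnerProductSpace.toDual_symm_apply, LinearMap.coe_toContinuousLinearMap']
  have h := LinearMap.congr_fun hφ (Basis.span hf i)
  rw [Basis.constr_basis] at h
  simpa [Basis.span_apply] using h

theorem prod_sub_mem_span {n : ℕ} {l : List (Iso n)} {S : Submodule ℝ (Euc n)}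
    (h : ∀ r ∈ l, ∀ x, r x - x ∈ S) (x : Euc n) : l.prod x - x ∈ S := by
  induction l with
  | nil => simp
  | cons r l ih =>
    rw [List.forall_mem_cons] at h
    rw [List.prod_cons, IsometryEquiv.mul_apply, ← sub_add_sub_cancel _ (l.prod x)]
    exact add_mem (h.1 _) (ih h.2)

theorem prod_apply_eq_self {n : ℕ} {l : List (Iso n)} {x : Euc n}
    (h : ∀ r ∈ l, r x = x) : l.prod x = x := by
  induction l with
  | nil => simp
  | cons r l ih =>
    rw [List.forall_mem_cons] at h
    rw [List.prod_cons, IsometryEquiv.mul_apply, ih h.2, h.1]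

theorem map_sub_self_notMem_moveDir {n : ℕ} {w : Iso n} (hw : (0 : Euc n) ∉ MovSet n w)
    (x : Euc n) : w x - x ∉ moveDir n w := by
  intro h
  obtain ⟨y, hy⟩ := mem_moveDir.1 h
  refine hw ⟨y + x, ?_⟩
  rw [map_eq_linear_add w (y + x) x, add_sub_cancel_right,
    IsometryEquiv.toRealLinearIsometryEquiv_apply, add_sub_add_comm, ← hy]
  abel

theorem finrank_moveDir_add_two_le_length {n : ℕ} {w : Iso n} (hw : (0 : Euc n) ∉ MovSet n w)
    {l : List (Iso n)} (hl : ∀ r ∈ l, IsReflection n r) (hprod : l.prod = w) :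
    finrank ℝ (moveDir n w) + 2 ≤ l.length := by
  have hform (i : Fin l.length) : ∃ p α, l.get i = reflAt n p α := by
    obtain ⟨p, α, -, h⟩ := (hl _ (l.get_mem i)).exists_eq_reflAt
    exact ⟨p, α, h⟩
  choose p α hα using hform
  have hmem (x : Euc n) : w x - x ∈ span ℝ (Set.range α) := by
    rw [← hprod]
    refine prod_sub_mem_span (fun r hr y => ?_) x
    obtain ⟨i, rfl⟩ := List.get_of_mem hr
    rw [hα]
    exact span_mono (by simp) (reflAt_sub_mem_span n (p i) (α i) y)
  have hlt : moveDir n w < span ℝ (Set.range α) := by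
    refine SetLike.lt_iff_le_and_exists.2 ⟨fun d hd => ?_, w 0, by simpa using hmem 0, fun h => ?_⟩
    · obtain ⟨x, rfl⟩ := mem_moveDir.1 hd
      have h : x - (w x - w 0) = (w 0 - 0) - (w x - x) := by abel
      rw [h]
      exact sub_mem (hmem 0) (hmem x)
    · exact map_sub_self_notMem_moveDir hw 0 (by simpa using h)
  have hlt' := finrank_lt_finrank_of_lt hlt
  by_contra! hlen
  have hind : LinearIndependent ℝ α := by
    rw [linearIndependent_iff_card_le_finrank_span, Fintype.card_fin, Set.finrank]
    omega
  obtain ⟨x, hx⟩ := exists_inner_eq_of_linearIndependent hind fun i => ⟪α i, p i⟫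
  refine hw ⟨x, ?_⟩
  rw [← hprod, sub_eq_zero]
  refine prod_apply_eq_self fun r hr => ?_
  obtain ⟨i, rfl⟩ := List.get_of_mem hr
  rw [hα, reflAt_eq_self_iff, inner_sub_right, hx, sub_self]

theorem reflLen_le {n : ℕ} {w : Iso n} {l : List (Iso n)} (hl : ∀ r ∈ l, IsReflection n r)
    (hprod : l.prod = w) : reflLen n w ≤ l.length :=
  Nat.sInf_le ⟨l, rfl, hl, hprod⟩

theorem exists_list_length_eq_reflLen (n : ℕ) (w : Iso n) :
    ∃ l : List (Iso n), l.length = reflLen n w ∧ (∀ r ∈ l, IsReflection n r) ∧ l.prod = w := by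
  obtain ⟨l, -, hl⟩ := exists_list_length_le n w
  exact Nat.sInf_mem (s := {k | ∃ l : List (Iso n), l.length = k ∧
    (∀ r ∈ l, IsReflection n r) ∧ l.prod = w}) ⟨l.length, l, rfl, hl⟩

theorem reflLen_of_hyperbolic {n : ℕ} {w : Iso n} (hw : (0 : Euc n) ∉ MovSet n w) :
    reflLen n w = finrank ℝ (moveDir n w) + 2 := by
  obtain ⟨l, hlen, hl, hprod⟩ := exists_list_length_le n w
  obtain ⟨l', hlen', hl', hprod'⟩ := exists_list_length_eq_reflLen n w
  have := reflLen_le hl hprod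
  have := finrank_moveDir_add_two_le_length hw hl' hprod'
  omega

/-- `w` hyperbolic with `ℓ(w) = k`, `Mov(w) = U + μ` in standard form,
`r` a reflection with root `α`.  If `α ∈ U` then `rw` is hyperbolic with
`ℓ(rw) = k − 1`. -/
theorem mult_by_reflection_root_in_U (n k : ℕ) (w r : Iso n)
    (U : Submodule ℝ (Euc n)) (μ α : Euc n)
    (hhyp : (0 : Euc n) ∉ MovSet n w)
    (hk : reflLen n w = k)
    (hU : (U : Set (Euc n)) = dirSet n (MovSet n w))
    (hμmem : μ ∈ MovSet n w) (hμperp : μ ∈ Uᗮ)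
    (hr : IsReflection n r) (hroot : IsRoot n r α)
    (hα : α ∈ U) :
    (0 : Euc n) ∉ MovSet n (r * w) ∧ reflLen n (r * w) = k - 1 := by
  have hmove : U = moveDir n w := SetLike.coe_injective (hU.trans (dirSet_movSet n w))
  subst hmove
  obtain ⟨p, rfl⟩ := hroot.eq_reflAt hr
  have hhyp' : (0 : Euc n) ∉ MovSet n (reflAt n p α * w) := by
    rintro ⟨x, hx⟩
    have h : w x - x = -(reflAt n p α (w x) - w x) := by
      rw [IsometryEquiv.mul_apply, sub_eq_zero] at hx
      rw [hx, neg_sub]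
    apply map_sub_self_notMem_moveDir hhyp x
    rw [h]
    exact neg_mem ((span_singleton_le_iff_mem _ _).2 hα (reflAt_sub_mem_span n p α _))
  refine ⟨hhyp', ?_⟩
  have hlt := finrank_moveDir_reflAt_mul_lt p hroot.1 hα
  have hle := finrank_moveDir_reflAt_mul_le n p α (reflAt n p α * w)
  rw [← mul_assoc, reflAt_mul_self, one_mul] at hle
  rw [← hk, reflLen_of_hyperbolic hhyp, reflLen_of_hyperbolic hhyp']
  omega
end
end

section
/- Let w be a hyperbolic isometry of E = ℝⁿ with reflection length ℓ(w) = k, write Mov(w) = U + μ in standard form, let r be a reflection with root α, and let U_α denote the linear span of U ∪ {α}. If α ∉ U and μ ∉ U_α, then the isometry rw is hyperbolic and ℓ(rw) = k + 1. -/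
open scoped RealInnerProductSpace

noncomputable section

lemma reflLen_le_length {n : ℕ} {w : Iso n} (l : List (Iso n))
    (hl : ∀ r ∈ l, IsReflection n r) (hprod : l.prod = w) : reflLen n w ≤ l.length :=
  Nat.sInf_le ⟨l, rfl, hl, hprod⟩

/-- An isometry fixing pointwise an affine subspace moves every point orthogonally to it. -/
lemma sub_mem_direction_orthogonal {n : ℕ} {r : Iso n} {H : AffineSubspace ℝ (Euc n)}
    (hne : (H : Set (Euc n)).Nonempty) (hfix : ∀ x ∈ H, r x = x) (x : Euc n) :
    r x - x ∈ H.directionᗮ := by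
  obtain ⟨p, hp⟩ := hne
  rw [Submodule.mem_orthogonal]
  intro d hd
  have hq : p + d ∈ H := by
    simpa [add_comm] using AffineSubspace.vadd_mem_of_mem_direction hd hp
  have hdist : ∀ q ∈ H, ‖r x - q‖ = ‖x - q‖ := by
    intro q hq
    rw [← dist_eq_norm, ← dist_eq_norm]
    nth_rewrite 1 [← hfix q hq]
    exact r.dist_eq x q
  have hpd : ‖(r x - p) - d‖ = ‖(x - p) - d‖ := by
    simpa [sub_sub] using hdist _ hq
  have h₁ := norm_sub_sq_real (r x - p) d
  have h₂ := norm_sub_sq_real (x - p) d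
  rw [hpd, hdist p hp] at h₁
  have h₃ : ⟪r x - x, d⟫ = ⟪r x - p, d⟫ - ⟪x - p, d⟫ := by
    rw [← inner_sub_left]; congr 1; abel
  rw [real_inner_comm, h₃]
  linarith

lemma orthogonal_eq_span_singleton {n : ℕ} {W : Submodule ℝ (Euc n)}
    (hW : Module.finrank ℝ W + 1 = n) {α : Euc n} (hα : α ≠ 0) (hmem : α ∈ Wᗮ) :
    Wᗮ = Submodule.span ℝ {α} := by
  symm
  apply Submodule.eq_of_le_of_finrank_eq
  · rwa [Submodule.span_singleton_le_iff_mem]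
  · have := W.finrank_add_finrank_orthogonal
    rw [finrank_euclideanSpace_fin] at this
    rw [finrank_span_singleton hα]
    omega

/-- A reflection moves points along a line and fixes a hyperplane orthogonal to it. -/
lemma IsReflection.exists_vector {n : ℕ} {r : Iso n} (hr : IsReflection n r) :
    ∃ α p : Euc n, (∀ x, r x - x ∈ Submodule.span ℝ {α}) ∧
      ∀ x, ⟪α, x - p⟫ = 0 → r x = x := by
  obtain ⟨-, H, hne, hdim, hfix⟩ := hr
  have hfr : Module.finrank ℝ H.directionᗮ = 1 := by
    have := H.direction.finrank_add_finrank_orthogonal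
    rw [finrank_euclideanSpace_fin] at this
    omega
  obtain ⟨α, hαmem, hα⟩ : ∃ α ∈ H.directionᗮ, α ≠ 0 := by
    apply Submodule.exists_mem_ne_zero_of_ne_bot
    intro h
    rw [h, finrank_bot] at hfr
    exact zero_ne_one hfr
  have hspan := orthogonal_eq_span_singleton hdim hα hαmem
  obtain ⟨p, hp⟩ := id hne
  refine ⟨α, p, fun x => hspan ▸ sub_mem_direction_orthogonal hne hfix x, fun x hx => ?_⟩
  apply hfix
  have hd : x - p ∈ H.direction := by
    rw [← H.direction.orthogonal_orthogonal, hspan]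
    exact Submodule.mem_orthogonal_singleton_iff_inner_right.2 hx
  simpa using AffineSubspace.vadd_mem_of_mem_direction hd hp

lemma IsRoot.sub_mem_span {n : ℕ} {r : Iso n} {α : Euc n} (hroot : IsRoot n r α)
    (hr : IsReflection n r) (x : Euc n) : r x - x ∈ Submodule.span ℝ {α} := by
  obtain ⟨-, H, ⟨p, hp⟩, hdim, hfix⟩ := hr
  have hmem : α ∈ H.directionᗮ := by
    rw [Submodule.mem_orthogonal']
    intro d hd
    have hq : d + p ∈ H := AffineSubspace.vadd_mem_of_mem_direction hd hp
    simpa using hroot.2 p (d + p) (hfix p hp) (hfix _ hq)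
  rw [← orthogonal_eq_span_singleton hdim hroot.1 hmem]
  exact sub_mem_direction_orthogonal ⟨p, hp⟩ hfix x

/-- A product of `m` reflections moves points within a subspace of dimension at most `m`; if
the dimension is exactly `m`, the product fixes a translate of the orthogonal complement. -/
lemma exists_subspace_of_reflections {n : ℕ} (l : List (Iso n))
    (hl : ∀ r ∈ l, IsReflection n r) :
    ∃ S : Submodule ℝ (Euc n), Module.finrank ℝ S ≤ l.length ∧ (∀ x, l.prod x - x ∈ S) ∧
      (Module.finrank ℝ S = l.length → ∃ c, ∀ v ∈ Sᗮ, l.prod (c + v) = c + v) := by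
  induction l with
  | nil => exact ⟨⊥, by simp, by simp, fun _ => ⟨0, by simp⟩⟩
  | cons r l ih =>
    obtain ⟨S, hdim, hmov, hfix⟩ := ih fun s hs => hl s (List.mem_cons_of_mem _ hs)
    obtain ⟨α, p, hspan, hplane⟩ := (hl r List.mem_cons_self).exists_vector
    have hmov' : ∀ x, (r :: l).prod x - x ∈ S ⊔ Submodule.span ℝ {α} := by
      intro x
      have h := Submodule.add_mem_sup (hmov x) (hspan (l.prod x))
      rw [List.prod_cons, IsometryEquiv.mul_apply]
      convert h using 1
      abel
    by_cases hα : α ∈ S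
    · have hS : S ⊔ Submodule.span ℝ {α} = S := by simpa using hα
      rw [hS] at hmov'
      refine ⟨S, by simp; omega, hmov', fun h => ?_⟩
      simp at h
      omega
    · have hS := Submodule.finrank_sup_span_singleton hα
      refine ⟨S ⊔ Submodule.span ℝ {α}, by simp; omega, hmov', fun h => ?_⟩
      obtain ⟨c, hc⟩ := hfix (by simp at h; omega)
      obtain ⟨v, hv, hαv⟩ : ∃ v ∈ Sᗮ, ⟪α, v⟫ ≠ 0 := by
        by_contra! hcon
        exact hα (S.orthogonal_orthogonal ▸ (Submodule.mem_orthogonal' _ _).2 hcon)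
      set t : ℝ := -⟪α, c - p⟫ / ⟪α, v⟫ with ht
      refine ⟨c + t • v, fun u hu => ?_⟩
      rw [← Submodule.inf_orthogonal] at hu
      have hl' : l.prod (c + t • v + u) = c + t • v + u := by
        rw [add_assoc]
        exact hc _ (Sᗮ.add_mem (Sᗮ.smul_mem _ hv) hu.1)
      rw [List.prod_cons, IsometryEquiv.mul_apply, hl']
      apply hplane
      have hu' := Submodule.mem_orthogonal_singleton_iff_inner_right.1 hu.2
      have he : c + t • v + u - p = (c - p) + t • v + u := by abel
      rw [he, inner_add_right, inner_add_right, inner_smul_right, hu', ht]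
      field_simp
      ring

/-- The map `y ↦ c + ρ (y - c)`, where `ρ` is the reflection in the orthogonal of `v`. -/
def pointReflection (n : ℕ) (c v : Euc n) : Iso n :=
  ((IsometryEquiv.subRight c).trans
    ((Submodule.span ℝ {v})ᗮ.reflection).toIsometryEquiv).trans (IsometryEquiv.addRight c)

lemma pointReflection_apply {n : ℕ} (c v y : Euc n) :
    pointReflection n c v y = (Submodule.span ℝ {v})ᗮ.reflection (y - c) + c := rfl

lemma isReflection_pointReflection {n : ℕ} (c : Euc n) {v : Euc n} (hv : v ≠ 0) :
    IsReflection n (pointReflection n c v) := by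
  refine ⟨fun h => ?_, AffineSubspace.mk' c (Submodule.span ℝ {v})ᗮ,
    AffineSubspace.mk'_nonempty _ _, ?_, fun x hx => ?_⟩
  · have h₁ := congrArg (fun g : Iso n => g (v + c)) h
    simp only [pointReflection_apply, add_sub_cancel_right,
      Submodule.reflection_orthogonalComplement_singleton_eq_neg, IsometryEquiv.coe_one,
      id_eq, add_left_inj] at h₁
    have h₂ : (2 : ℝ) • v = 0 := by
      rw [two_smul]
      nth_rewrite 1 [← h₁]
      exact neg_add_cancel v
    exact hv ((smul_eq_zero_iff_right two_ne_zero).1 h₂)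
  · have := (Submodule.span ℝ {v}).finrank_add_finrank_orthogonal
    rw [finrank_euclideanSpace_fin, finrank_span_singleton hv] at this
    rw [AffineSubspace.direction_mk']
    omega
  · rw [AffineSubspace.mem_mk', vsub_eq_sub] at hx
    rw [pointReflection_apply, Submodule.reflection_mem_subspace_eq_self hx, sub_add_cancel]

lemma exists_reflections_of_vectors {n : ℕ} (c : Euc n) (l : List (Euc n)) :
    ∃ l' : List (Iso n), l'.length ≤ l.length ∧ (∀ r ∈ l', IsReflection n r) ∧
      ∀ y, l'.prod y =
        (l.map fun v => (Submodule.span ℝ {v})ᗮ.reflection).prod (y - c) + c := by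
  induction l with
  | nil => exact ⟨[], by simp, by simp, by simp⟩
  | cons v l ih =>
    obtain ⟨l', hlen, hrefl, hprod⟩ := ih
    by_cases hv : v = 0
    · refine ⟨l', by simp; omega, hrefl, fun y => ?_⟩
      rw [hprod, List.map_cons, List.prod_cons, LinearIsometryEquiv.coe_mul, Function.comp_apply,
        Submodule.reflection_mem_subspace_eq_self (by simp [hv])]
    · refine ⟨pointReflection n c v :: l', by simpa using hlen, ?_, fun y => ?_⟩
      · simpa using ⟨isReflection_pointReflection c hv, hrefl⟩
      · rw [List.prod_cons, IsometryEquiv.mul_apply, hprod, pointReflection_apply,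
          add_sub_cancel_right]
        simp

/-- An isometry fixing a translate of `Sᗮ` is a product of at most `dim S` reflections. -/
lemma exists_reflections_of_fixed_s6 {n : ℕ} (g : Iso n) (c : Euc n) (S : Submodule ℝ (Euc n))
    (hfix : ∀ v ∈ Sᗮ, g (c + v) = c + v) :
    ∃ l : List (Iso n), l.length ≤ Module.finrank ℝ S ∧ (∀ r ∈ l, IsReflection n r) ∧
      l.prod = g := by
  have hc : g c = c := by simpa using hfix 0 (Submodule.zero_mem _)
  let f : Iso n := ((IsometryEquiv.addRight c).trans g).trans (IsometryEquiv.subRight c)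
  have hf : ∀ v, f v = g (v + c) - c := fun _ => rfl
  let A : Euc n ≃ₗᵢ[ℝ] Euc n := f.toRealLinearIsometryEquivOfMapZero (by simp [hf, hc])
  have hA : ∀ v, A v = g (v + c) - c := hf
  have hker : (ContinuousLinearMap.id ℝ (Euc n) - A).kerᗮ ≤ S := by
    rw [← S.orthogonal_orthogonal]
    apply Submodule.orthogonal_le
    intro v hv
    have h : A v = v := by rw [hA, add_comm, hfix v hv]; abel
    simp [h]
  obtain ⟨l, hlen, hprod⟩ :=
    A.reflections_generate_dim_aux (Submodule.finrank_mono hker)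
  obtain ⟨l', hlen', hrefl, hprod'⟩ := exists_reflections_of_vectors c l
  refine ⟨l', hlen'.trans hlen, hrefl, IsometryEquiv.ext fun y => ?_⟩
  rw [hprod', ← hprod, hA]
  simp

lemma map_add_of_mem_orthogonal {n : ℕ} {w : Iso n} {U : Submodule ℝ (Euc n)}
    (hU : (U : Set (Euc n)) = dirSet n (MovSet n w)) (x : Euc n) {v : Euc n} (hv : v ∈ Uᗮ) :
    w (x + v) = w x + v := by
  have hmem : (w (x + v) - w x) - v ∈ U := by
    rw [← SetLike.mem_coe, hU]
    exact ⟨_, ⟨x + v, rfl⟩, _, ⟨x, rfl⟩, by abel⟩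
  have hnorm : ‖w (x + v) - w x‖ = ‖v‖ := by
    rw [← dist_eq_norm, w.dist_eq, dist_eq_norm, add_sub_cancel_left]
  have hinner := (Submodule.mem_orthogonal _ _).1 hv _ hmem
  rw [inner_sub_left, real_inner_self_eq_norm_sq] at hinner
  have h := norm_sub_sq_real (w (x + v) - w x) v
  rw [hnorm] at h
  have hzero : ‖(w (x + v) - w x) - v‖ = 0 := by
    rw [← sq_eq_zero_iff, h]
    linarith
  rw [norm_eq_zero, sub_sub, sub_eq_zero] at hzero
  exact hzero

/-- An isometry whose move-set is not contained in `U = Dir(Mov(w))` is a product of at most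
`dim U + 2` reflections. -/
lemma exists_reflections_of_mem_movSet {n : ℕ} {w : Iso n} {U : Submodule ℝ (Euc n)}
    (hU : (U : Set (Euc n)) = dirSet n (MovSet n w))
    {μ : Euc n} (hμmem : μ ∈ MovSet n w) (hμU : μ ∉ U) :
    ∃ l : List (Iso n), l.length ≤ Module.finrank ℝ U + 2 ∧ (∀ r ∈ l, IsReflection n r) ∧
      l.prod = w := by
  have hμ : μ ≠ 0 := fun h => hμU (h ▸ U.zero_mem)
  obtain ⟨x, hx⟩ := hμmem
  have hwx : w x = x + μ := by rw [← hx]; abel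
  set t := pointReflection n (x + (1 / 2 : ℝ) • μ) μ with ht
  have htt : t * t = 1 := by
    ext1 y
    simp [ht, pointReflection_apply]
  obtain ⟨l, hlen, hrefl, hprod⟩ :=
    exists_reflections_of_fixed_s6 (t * w) x (U ⊔ Submodule.span ℝ {μ}) (by
      intro v hv
      rw [← Submodule.inf_orthogonal] at hv
      rw [IsometryEquiv.mul_apply, map_add_of_mem_orthogonal hU x hv.1, hwx, ht,
        pointReflection_apply]
      have he : x + μ + v - (x + (1 / 2 : ℝ) • μ) = (1 / 2 : ℝ) • μ + v := by module
      rw [he, map_add, map_smul, Submodule.reflection_orthogonalComplement_singleton_eq_neg,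
        Submodule.reflection_mem_subspace_eq_self hv.2]
      module)
  refine ⟨t :: l, ?_, ?_, ?_⟩
  · rw [Submodule.finrank_sup_span_singleton hμU] at hlen
    simpa using hlen
  · simpa using ⟨isReflection_pointReflection _ hμ, hrefl⟩
  · rw [List.prod_cons, hprod, ← mul_assoc, htt, one_mul]

/-- `w` hyperbolic with `ℓ(w) = k`, `Mov(w) = U + μ` in standard form,
`r` a reflection with root `α`, `U_α` the span of `U ∪ {α}`.  If `α ∉ U` and
`μ ∉ U_α` then `rw` is hyperbolic with `ℓ(rw) = k + 1`. -/
theorem mult_by_reflection_mu_not_in_Ualpha (n k : ℕ) (w r : Iso n)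
    (U : Submodule ℝ (Euc n)) (μ α : Euc n)
    (hhyp : (0 : Euc n) ∉ MovSet n w)
    (hk : reflLen n w = k)
    (hU : (U : Set (Euc n)) = dirSet n (MovSet n w))
    (hμmem : μ ∈ MovSet n w) (hμperp : μ ∈ Uᗮ)
    (hr : IsReflection n r) (hroot : IsRoot n r α)
    (hα : α ∉ U) (hμα : μ ∉ U ⊔ Submodule.span ℝ {α}) :
    (0 : Euc n) ∉ MovSet n (r * w) ∧ reflLen n (r * w) = k + 1 := by
  have hspan := hroot.sub_mem_span hr
  have hUmem : ∀ x, w x - x - μ ∈ U := fun x => by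
    rw [← SetLike.mem_coe, hU]
    exact ⟨_, ⟨x, rfl⟩, μ, hμmem, rfl⟩
  have hμU : μ ∉ U := fun h => hμα (Submodule.mem_sup_left h)
  have hhyp' : (0 : Euc n) ∉ MovSet n (r * w) := by
    rintro ⟨x, hx⟩
    have h := Submodule.neg_mem _ (Submodule.add_mem_sup (hUmem x) (hspan (w x)))
    rw [IsometryEquiv.mul_apply, sub_eq_zero] at hx
    apply hμα
    rw [hx] at h
    convert h using 1
    abel
  refine ⟨hhyp', ?_⟩
  obtain ⟨l₀, hlen₀, hrefl₀, hprod₀⟩ := exists_reflections_of_mem_movSet hU hμmem hμU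
  have hk_le : k ≤ Module.finrank ℝ U + 2 :=
    hk ▸ (reflLen_le_length l₀ hrefl₀ hprod₀).trans hlen₀
  obtain ⟨l, hlen, hrefl, hprod⟩ := Nat.sInf_mem (s := {k | ∃ l : List (Iso n),
    l.length = k ∧ (∀ r ∈ l, IsReflection n r) ∧ l.prod = w}) ⟨_, l₀, rfl, hrefl₀, hprod₀⟩
  have hlen : l.length = k := hlen.trans hk
  have hcons : ∃ l' : List (Iso n), l'.length = k + 1 ∧ (∀ s ∈ l', IsReflection n s) ∧
      l'.prod = r * w :=
    ⟨r :: l, by simp [hlen], by simpa using ⟨hr, hrefl⟩, by simp [hprod]⟩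
  apply le_antisymm (Nat.sInf_le hcons)
  refine le_csInf ⟨_, hcons⟩ ?_
  rintro m ⟨l', rfl, hrefl', hprod'⟩
  obtain ⟨S, hdim, hmov, hfix⟩ := exists_subspace_of_reflections l' hrefl'
  rw [hprod'] at hmov hfix
  have hne : Module.finrank ℝ S ≠ l'.length := fun h => by
    obtain ⟨c, hc⟩ := hfix h
    refine hhyp' ⟨c, ?_⟩
    simpa [sub_eq_zero] using hc 0 (Submodule.zero_mem _)
  have hαS : α ∈ S := by
    obtain ⟨v, hv, hαv⟩ : ∃ v ∈ Uᗮ, ⟪α, v⟫ ≠ 0 := by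
      by_contra! hcon
      exact hα (U.orthogonal_orthogonal ▸ (Submodule.mem_orthogonal' _ _).2 hcon)
    obtain ⟨-, H, ⟨p, hp⟩, -, hH⟩ := hr
    obtain ⟨x, rfl⟩ := w.surjective p
    have h := S.sub_mem (hmov (x + v)) (hmov x)
    rw [IsometryEquiv.mul_apply, IsometryEquiv.mul_apply, map_add_of_mem_orthogonal hU x hv,
      hH _ hp] at h
    obtain ⟨a, ha⟩ := Submodule.mem_span_singleton.1 (hspan (w x + v))
    have ha0 : a ≠ 0 := by
      rintro rfl
      rw [zero_smul, eq_comm, sub_eq_zero] at ha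
      exact hαv (by simpa using hroot.2 _ _ (hH _ hp) ha)
    have he : r (w x + v) - (x + v) - (w x - x) = a • α := by rw [ha]; abel
    rwa [he, S.smul_mem_iff ha0] at h
  have hwS : ∀ x, w x - x ∈ S := fun x => by
    have h := S.sub_mem (hmov x)
      ((Submodule.span_singleton_le_iff_mem _ _).2 hαS (hspan (w x)))
    rw [IsometryEquiv.mul_apply] at h
    convert h using 1
    abel
  have hle : (U ⊔ Submodule.span ℝ {α}) ⊔ Submodule.span ℝ {μ} ≤ S := by
    refine sup_le (sup_le (fun u hu => ?_) ?_) ?_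
    · rw [← SetLike.mem_coe, hU] at hu
      obtain ⟨_, ⟨x, rfl⟩, _, ⟨y, rfl⟩, rfl⟩ := hu
      exact S.sub_mem (hwS x) (hwS y)
    · rwa [Submodule.span_singleton_le_iff_mem]
    · obtain ⟨x, rfl⟩ := hμmem
      rw [Submodule.span_singleton_le_iff_mem]
      exact hwS x
  have hfr := Submodule.finrank_mono hle
  rw [Submodule.finrank_sup_span_singleton hμα, Submodule.finrank_sup_span_singleton hα] at hfr
  omega
end
end

section
/- Let w be an elliptic isometry of E = ℝⁿ with fix-set Fix(w). Then the map u ↦ Fix(u) is an order-reversing bijection from the interval [1,w] (with its betweenness partial order) onto the set of all affine subspaces of E containing Fix(w), ordered by inclusion; i.e., it is a poset isomorphism onto the affine subspaces containing Fix(w) under reverse inclusion. -/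
open scoped RealInnerProductSpace

noncomputable section

/-- The linear span of the move-set of an isometry. -/
def moveSpan (n : ℕ) (w : Iso n) : Submodule ℝ (Euc n) := Submodule.span ℝ (MovSet n w)

/-- The dimension of the linear span of the move-set of an isometry. -/
def moveDim (n : ℕ) (w : Iso n) : ℕ := Module.finrank ℝ (moveSpan n w)

section

variable {n : ℕ} {u v w r : Iso n} {p x y : Euc n}

lemma apply_sub_self_mem_moveSpan (w : Iso n) (x : Euc n) : w x - x ∈ moveSpan n w :=
  Submodule.subset_span ⟨x, rfl⟩

lemma moveSpan_le_iff_forall {S : Submodule ℝ (Euc n)} :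
    moveSpan n w ≤ S ↔ ∀ x, w x - x ∈ S :=
  Submodule.span_le.trans
    ⟨fun h x => h ⟨x, rfl⟩, by rintro h _ ⟨x, rfl⟩; exact h x⟩

lemma moveSpan_one : moveSpan n 1 = ⊥ :=
  le_bot_iff.1 (moveSpan_le_iff_forall.2 fun x => by simp)

lemma moveDim_one : moveDim n 1 = 0 := by
  rw [moveDim, moveSpan_one, finrank_bot]

lemma eq_one_of_moveSpan_le_bot (h : moveSpan n w ≤ ⊥) : w = 1 := by
  ext1 x
  simpa [sub_eq_zero] using moveSpan_le_iff_forall.1 h x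

lemma moveSpan_inv_le (w : Iso n) : moveSpan n w⁻¹ ≤ moveSpan n w :=
  moveSpan_le_iff_forall.2 fun x => by
    have h := neg_mem (apply_sub_self_mem_moveSpan w (w⁻¹ x))
    rwa [IsometryEquiv.apply_inv_self, neg_sub] at h

lemma moveSpan_inv (w : Iso n) : moveSpan n w⁻¹ = moveSpan n w :=
  (moveSpan_inv_le w).antisymm (by simpa using moveSpan_inv_le w⁻¹)

lemma moveSpan_mul_le (u v : Iso n) : moveSpan n (u * v) ≤ moveSpan n u ⊔ moveSpan n v :=
  moveSpan_le_iff_forall.2 fun x => by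
    have h := add_mem
      (Submodule.mem_sup_left (T := moveSpan n v) (apply_sub_self_mem_moveSpan u (v x)))
      (Submodule.mem_sup_right (S := moveSpan n u) (apply_sub_self_mem_moveSpan v x))
    rwa [sub_add_sub_cancel] at h

lemma moveDim_mul_le (u v : Iso n) : moveDim n (u * v) ≤ moveDim n u + moveDim n v :=
  (Submodule.finrank_mono (moveSpan_mul_le u v)).trans
    (Submodule.finrank_add_le_finrank_add_finrank _ _)

lemma disjoint_moveSpan (h : moveDim n (u * v) = moveDim n u + moveDim n v) :
    Disjoint (moveSpan n u) (moveSpan n v) := by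
  rw [disjoint_iff, ← Submodule.finrank_eq_zero (R := ℝ)]
  have h₁ := Submodule.finrank_mono (moveSpan_mul_le u v)
  have h₂ := Submodule.finrank_sup_add_finrank_inf_eq (moveSpan n u) (moveSpan n v)
  unfold moveDim at h
  omega

lemma fixes_of_mul_fixes (h : moveDim n (u * v) = moveDim n u + moveDim n v)
    (hx : (u * v) x = x) : u x = x ∧ v x = x := by
  have h₁ : v x - x = -(u (v x) - v x) := by
    rw [IsometryEquiv.mul_apply] at hx
    rw [hx, neg_sub]
  have h₂ : v x - x = 0 :=
    Submodule.disjoint_def.1 (disjoint_moveSpan h) _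
      (h₁ ▸ neg_mem (apply_sub_self_mem_moveSpan u (v x))) (apply_sub_self_mem_moveSpan v x)
  have h₃ : v x = x := sub_eq_zero.1 h₂
  rw [IsometryEquiv.mul_apply, h₃] at hx
  exact ⟨hx, h₃⟩

lemma moveSpan_le_orthogonal_direction {H : AffineSubspace ℝ (Euc n)} (h : ∀ x ∈ H, r x = x)
    (hne : (H : Set (Euc n)).Nonempty) : moveSpan n r ≤ H.directionᗮ := by
  obtain ⟨p, hp⟩ := hne
  refine moveSpan_le_iff_forall.2 fun x => ?_
  rw [Submodule.mem_orthogonal]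
  intro d hd
  have hmem : ∀ a ∈ H, a ∈ AffineSubspace.perpBisector x (r x) := fun a ha => by
    rw [AffineSubspace.mem_perpBisector_iff_dist_eq, ← r.dist_eq a x, h a ha]
  have hle : H.direction ≤ (AffineSubspace.perpBisector x (r x)).direction :=
    AffineSubspace.direction_le hmem
  have := hle hd
  rw [AffineSubspace.direction_perpBisector, Submodule.mem_orthogonal_singleton_iff_inner_left]
    at this
  simpa using this

lemma moveDim_le_one_of_isReflection (h : IsReflection n r) : moveDim n r ≤ 1 := by
  obtain ⟨-, H, hne, hdim, hfix⟩ := h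
  have h₁ := Submodule.finrank_mono (moveSpan_le_orthogonal_direction hfix hne)
  have h₂ := Submodule.finrank_add_finrank_orthogonal H.direction
  rw [finrank_euclideanSpace_fin] at h₂
  unfold moveDim
  omega

lemma inner_apply_sub_self_ne_zero (hp : w p = p) (hx : w x ≠ x) : ⟪w x - x, x - p⟫ ≠ 0 := by
  intro h₁
  have h₂ : ‖(w x - x) + (x - p)‖ = ‖x - p‖ := by
    rw [sub_add_sub_cancel, ← dist_eq_norm, ← dist_eq_norm, ← w.dist_eq x p, hp]
  have h₃ := norm_add_sq_real (w x - x) (x - p)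
  rw [h₁, h₂] at h₃
  have h₄ : ‖w x - x‖ = 0 := by nlinarith
  exact hx (sub_eq_zero.1 (norm_eq_zero.1 h₄))

lemma apply_eq_self_iff_sub_mem_orthogonal (hp : w p = p) :
    w x = x ↔ x - p ∈ (moveSpan n w)ᗮ := by
  constructor
  · intro hx
    rw [Submodule.mem_orthogonal]
    intro d hd
    suffices hle : moveSpan n w ≤ (ℝ ∙ (x - p))ᗮ from
      Submodule.mem_orthogonal_singleton_iff_inner_left.1 (hle hd)
    refine moveSpan_le_iff_forall.2 fun y => ?_
    have hmem : ∀ a, w a = a → a ∈ AffineSubspace.perpBisector y (w y) := fun a ha => by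
      rw [AffineSubspace.mem_perpBisector_iff_dist_eq, ← w.dist_eq a y, ha]
    have hdir := AffineSubspace.vsub_mem_direction (hmem x hx) (hmem p hp)
    rw [AffineSubspace.direction_perpBisector,
      Submodule.mem_orthogonal_singleton_iff_inner_left] at hdir
    rw [Submodule.mem_orthogonal_singleton_iff_inner_left, real_inner_comm]
    simpa using hdir
  · intro hx
    by_contra hne
    exact inner_apply_sub_self_ne_zero hp hne
      ((Submodule.mem_orthogonal _ _).1 hx _ (apply_sub_self_mem_moveSpan w x))

lemma fixSet_eq_mk' (hp : w p = p) :
    FixSet n w = (AffineSubspace.mk' p (moveSpan n w)ᗮ : Set (Euc n)) := by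
  ext x
  rw [SetLike.mem_coe, AffineSubspace.mem_mk', vsub_eq_sub]
  exact apply_eq_self_iff_sub_mem_orthogonal hp

lemma moveSpan_le_moveSpan_iff (hu : u p = p) (hw : w p = p) :
    moveSpan n u ≤ moveSpan n w ↔ FixSet n w ⊆ FixSet n u := by
  rw [fixSet_eq_mk' hu, fixSet_eq_mk' hw, ← Submodule.orthogonal_le_orthogonal_iff]
  constructor
  · intro h x hx
    exact h hx
  · intro h x hx
    simpa using @h (x +ᵥ p) (by simpa using hx)

lemma exists_isReflection_swap (hxy : x ≠ y) :
    ∃ r, IsReflection n r ∧ r * r = 1 ∧ r x = y ∧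
      ∀ z ∈ AffineSubspace.perpBisector x y, r z = z := by
  have : Nonempty (AffineSubspace.perpBisector x y) :=
    AffineSubspace.perpBisector_nonempty.to_subtype
  set R := EuclideanGeometry.reflection (AffineSubspace.perpBisector x y) with hR
  have hswap : R x = y := by
    have hmid := AffineSubspace.midpoint_mem_perpBisector x y
    have hv : x -ᵥ midpoint ℝ x y ∈ (AffineSubspace.perpBisector x y).directionᗮ := by
      rw [AffineSubspace.direction_perpBisector, Submodule.orthogonal_orthogonal,
        left_vsub_midpoint, ← neg_vsub_eq_vsub_rev y x, smul_neg]
      exact neg_mem (Submodule.smul_mem _ _ (Submodule.mem_span_singleton_self _))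
    have h := EuclideanGeometry.reflection_orthogonal_vadd hmid hv
    rw [vsub_vadd] at h
    rw [hR, h, left_vsub_midpoint, ← smul_neg, neg_vsub_eq_vsub_rev, ← right_vsub_midpoint,
      vsub_vadd]
  have hfix : ∀ z ∈ AffineSubspace.perpBisector x y, R z = z := fun z hz =>
    (EuclideanGeometry.reflection_eq_self_iff z).2 hz
  refine ⟨R.toIsometryEquiv, ⟨?_, _, AffineSubspace.perpBisector_nonempty, ?_, hfix⟩, ?_, hswap,
    hfix⟩
  · intro h
    have h₁ : R x = x := congrArg (fun f : Iso n => f x) h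
    exact hxy (h₁.symm.trans hswap)
  · rw [AffineSubspace.direction_perpBisector]
    have h₁ := Submodule.finrank_add_finrank_orthogonal (ℝ ∙ (y -ᵥ x))
    rw [finrank_span_singleton (vsub_ne_zero.2 hxy.symm), finrank_euclideanSpace_fin] at h₁
    omega
  · ext1 z
    change R (R z) = z
    rw [hR, EuclideanGeometry.reflection_reflection]

lemma exists_mul_isReflection (hp : w p = p) (hx : w x ≠ x) :
    ∃ u r, w = u * r ∧ IsReflection n r ∧ u p = p ∧ moveDim n u + 1 = moveDim n w ∧
      ∀ S ≤ moveSpan n w, x - p ∈ Sᗮ → S ≤ moveSpan n u := by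
  have hxy : x ≠ w⁻¹ x := fun h => hx (by
    conv_lhs => rw [h]
    exact w.apply_inv_self x)
  obtain ⟨r, hr, hrr, hrx, hrfix⟩ := exists_isReflection_swap hxy
  have hfix : FixSet n w ⊆ FixSet n (w * r) := fun z (hz : w z = z) => by
    have h : r z = z := hrfix z <| by
      rw [AffineSubspace.mem_perpBisector_iff_dist_eq, ← w.dist_eq z (w⁻¹ x), hz,
        w.apply_inv_self]
    change w (r z) = z
    rw [h, hz]
  have hup : (w * r) p = p := hfix hp
  have hux : (w * r) x = x := by
    rw [IsometryEquiv.mul_apply, hrx, w.apply_inv_self]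
  have hwu : w = w * r * r := by rw [mul_assoc, hrr, mul_one]
  have hle : moveSpan n (w * r) ≤ moveSpan n w := (moveSpan_le_moveSpan_iff hup hp).2 hfix
  have hlt : moveSpan n (w * r) < moveSpan n w := by
    refine lt_of_le_not_ge hle fun h => hx ?_
    exact (moveSpan_le_moveSpan_iff hp hup).1 h hux
  refine ⟨w * r, r, hwu, hr, hup, ?_, ?_⟩
  · have h₁ : moveDim n (w * r) < moveDim n w := Submodule.finrank_lt_finrank_of_lt hlt
    have h₂ := moveDim_mul_le (w * r) r
    rw [← hwu] at h₂
    have h₃ := moveDim_le_one_of_isReflection hr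
    omega
  · intro S hS hxS y hy
    have hrS : moveSpan n r ≤ ℝ ∙ (w⁻¹ x - x) := by
      have h := moveSpan_le_orthogonal_direction hrfix AffineSubspace.perpBisector_nonempty
      rwa [AffineSubspace.direction_perpBisector, Submodule.orthogonal_orthogonal,
        vsub_eq_sub] at h
    have h₁ := moveSpan_mul_le (w * r) r
    rw [← hwu] at h₁
    obtain ⟨m, hm, d, hd, rfl⟩ := Submodule.mem_sup.1 (h₁ (hS hy))
    obtain ⟨c, rfl⟩ := Submodule.mem_span_singleton.1 (hrS hd)
    have hxm : ⟪m, x - p⟫ = 0 :=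
      (Submodule.mem_orthogonal _ _).1 ((apply_eq_self_iff_sub_mem_orthogonal hup).1 hux) m hm
    have hxy' := (Submodule.mem_orthogonal _ _).1 hxS _ hy
    have hip : w⁻¹ p = p := by
      conv_lhs => rw [← hp]
      exact w.inv_apply_self p
    have hne := inner_apply_sub_self_ne_zero hip hxy.symm
    rw [inner_add_left, hxm, zero_add, real_inner_smul_left, mul_eq_zero] at hxy'
    rw [hxy'.resolve_right hne, zero_smul, add_zero]
    exact hm

lemma exists_apply_ne_of_ne_one (h : w ≠ 1) : ∃ x, w x ≠ x := by
  contrapose! h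
  ext1 x
  exact h x

lemma exists_isReflection_list (hp : w p = p) :
    ∃ l : List (Iso n), l.length = moveDim n w ∧ (∀ r ∈ l, IsReflection n r) ∧ l.prod = w := by
  induction hk : moveDim n w generalizing w with
  | zero =>
    refine ⟨[], rfl, by simp, ?_⟩
    rw [List.prod_nil, eq_one_of_moveSpan_le_bot (w := w)]
    exact (Submodule.finrank_eq_zero.1 hk).le
  | succ k ih =>
    have hw : w ≠ 1 := by
      rintro rfl
      rw [moveDim_one] at hk
      omega
    obtain ⟨x, hx⟩ := exists_apply_ne_of_ne_one hw
    obtain ⟨u, r, rfl, hr, hu, hdim, -⟩ := exists_mul_isReflection hp hx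
    obtain ⟨l, hl, hlr, rfl⟩ := ih hu (by omega)
    refine ⟨l ++ [r], by simp [hl], ?_, by simp⟩
    intro s hs
    rcases List.mem_append.1 hs with h | h
    · exact hlr s h
    · rwa [List.mem_singleton.1 h]

lemma reflLen_set_nonempty (w : Iso n) :
    {k | ∃ l : List (Iso n), l.length = k ∧ (∀ r ∈ l, IsReflection n r) ∧
      l.prod = w}.Nonempty := by
  by_cases h : w 0 = 0
  · obtain ⟨l, -, hl, hlw⟩ := exists_isReflection_list h
    exact ⟨_, l, rfl, hl, hlw⟩
  · obtain ⟨r, hr, hrr, hr0, -⟩ := exists_isReflection_swap h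
    obtain ⟨l, -, hl, hlw⟩ := exists_isReflection_list (w := r * w) (p := 0) hr0
    refine ⟨_, r :: l, rfl, List.forall_mem_cons.2 ⟨hr, hl⟩, ?_⟩
    rw [List.prod_cons, hlw, ← mul_assoc, hrr, one_mul]

lemma moveDim_prod_le_length (l : List (Iso n)) (hl : ∀ r ∈ l, IsReflection n r) :
    moveDim n l.prod ≤ l.length := by
  induction l with
  | nil => simp [moveDim_one]
  | cons r l ih =>
    rw [List.forall_mem_cons] at hl
    have h₁ := moveDim_mul_le r l.prod
    have h₂ := moveDim_le_one_of_isReflection hl.1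
    have h₃ := ih hl.2
    rw [List.prod_cons, List.length_cons]
    omega

lemma moveDim_le_reflLen (w : Iso n) : moveDim n w ≤ reflLen n w := by
  obtain ⟨l, hl, hlr, hlw⟩ := Nat.sInf_mem (reflLen_set_nonempty w)
  rw [reflLen, ← hl, ← hlw]
  exact moveDim_prod_le_length l hlr

lemma reflLen_eq_moveDim (hp : w p = p) : reflLen n w = moveDim n w :=
  (Nat.sInf_le (exists_isReflection_list hp)).antisymm (moveDim_le_reflLen w)

lemma moveDim_le_add_inv_mul (u w : Iso n) :
    moveDim n w ≤ moveDim n u + moveDim n (u⁻¹ * w) := by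
  simpa using moveDim_mul_le u (u⁻¹ * w)

/-- In the interval below an elliptic isometry, lengths may be replaced by dimensions of
move-sets. -/
lemma inInterval_iff_moveDim (hp : w p = p) :
    inInterval n w u ↔ moveDim n u + moveDim n (u⁻¹ * w) = moveDim n w := by
  unfold inInterval
  rw [reflLen_eq_moveDim hp]
  have h₁ := moveDim_le_add_inv_mul u w
  constructor
  · intro h
    have h₂ := moveDim_le_reflLen u
    have h₃ := moveDim_le_reflLen (u⁻¹ * w)
    omega
  · intro h
    obtain ⟨hu, hv⟩ := fixes_of_mul_fixes (u := u) (v := u⁻¹ * w) (x := p)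
      (by rw [mul_inv_cancel_left, h]) (by rwa [mul_inv_cancel_left])
    rw [reflLen_eq_moveDim hu, reflLen_eq_moveDim hv, h]

lemma fixes_of_inInterval (hp : w p = p) (h : inInterval n w u) (hx : w x = x) :
    u x = x ∧ (u⁻¹ * w) x = x :=
  fixes_of_mul_fixes (by rw [mul_inv_cancel_left, (inInterval_iff_moveDim hp).1 h])
    (by rwa [mul_inv_cancel_left])

lemma inInterval_trans (hp : w p = p) (hv : inInterval n w v) (hu : inInterval n v u) :
    inInterval n w u := by
  rw [inInterval_iff_moveDim (fixes_of_inInterval hp hv hp).1] at hu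
  rw [inInterval_iff_moveDim hp] at hv ⊢
  have h₁ := moveDim_le_add_inv_mul u w
  have h₂ := moveDim_mul_le (u⁻¹ * v) (v⁻¹ * w)
  rw [mul_assoc, mul_inv_cancel_left] at h₂
  omega

lemma exists_inInterval_moveSpan_eq (hp : w p = p) {S : Submodule ℝ (Euc n)}
    (hS : S ≤ moveSpan n w) : ∃ u, inInterval n w u ∧ moveSpan n u = S := by
  induction hk : moveDim n w generalizing w with
  | zero =>
    have h₁ : moveSpan n w = ⊥ := Submodule.finrank_eq_zero.1 hk
    refine ⟨w, (inInterval_iff_moveDim hp).2 (by simp [moveDim_one]), ?_⟩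
    rw [h₁] at hS ⊢
    exact (le_bot_iff.1 hS).symm
  | succ k ih =>
    by_cases hSw : moveSpan n w ≤ S
    · exact ⟨w, (inInterval_iff_moveDim hp).2 (by simp [moveDim_one]), hSw.antisymm hS⟩
    rw [← Submodule.orthogonal_le_orthogonal_iff, SetLike.not_le_iff_exists] at hSw
    obtain ⟨z, hzS, hzw⟩ := hSw
    have hx : w (z + p) ≠ z + p := by
      rwa [Ne, apply_eq_self_iff_sub_mem_orthogonal hp, add_sub_cancel_right]
    obtain ⟨v, r, rfl, hr, hv, hdim, hSv⟩ := exists_mul_isReflection hp hx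
    obtain ⟨u, hu, hus⟩ := ih hv (hSv S hS (by rwa [add_sub_cancel_right])) (by omega)
    refine ⟨u, inInterval_trans hp ?_ hu, hus⟩
    rw [inInterval_iff_moveDim hp, inv_mul_cancel_left]
    have h₁ := moveDim_le_one_of_isReflection hr
    have h₂ := moveDim_mul_le v r
    omega

lemma exists_inInterval_fixSet_eq (hp : w p = p) {A : AffineSubspace ℝ (Euc n)}
    (hA : FixSet n w ⊆ (A : Set (Euc n))) :
    ∃ u, inInterval n w u ∧ FixSet n u = (A : Set (Euc n)) := by
  have hpA : p ∈ A := hA hp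
  have hS : A.directionᗮ ≤ moveSpan n w := by
    rw [← Submodule.orthogonal_le_orthogonal_iff, Submodule.orthogonal_orthogonal]
    intro z hz
    have hzA : z + p ∈ A :=
      hA ((apply_eq_self_iff_sub_mem_orthogonal hp).2 (by rwa [add_sub_cancel_right]))
    simpa using AffineSubspace.vsub_mem_direction hzA hpA
  obtain ⟨u, hu, hus⟩ := exists_inInterval_moveSpan_eq hp hS
  refine ⟨u, hu, ?_⟩
  rw [fixSet_eq_mk' (fixes_of_inInterval hp hu hp).1, hus, Submodule.orthogonal_orthogonal,
    AffineSubspace.mk'_eq hpA]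

lemma fixSet_inv_mul_subset (hp : w p = p) (hv : inInterval n w v)
    (h : moveSpan n u = moveSpan n v) :
    FixSet n (u⁻¹ * w) ⊆ FixSet n (v⁻¹ * w) := by
  intro x (hx : u⁻¹ (w x) = x)
  have hdisj : Disjoint (moveSpan n v) (moveSpan n (v⁻¹ * w)) :=
    disjoint_moveSpan (by rw [mul_inv_cancel_left, (inInterval_iff_moveDim hp).1 hv])
  have h₁ : w x - x ∈ moveSpan n v := by
    have h₂ := apply_sub_self_mem_moveSpan u (u⁻¹ (w x))
    rwa [u.apply_inv_self, hx, h] at h₂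
  have h₂ : v⁻¹ (w x) - w x ∈ moveSpan n v := by
    rw [← moveSpan_inv]
    exact apply_sub_self_mem_moveSpan _ _
  have h₃ : v⁻¹ (w x) - x ∈ moveSpan n v := by
    simpa using add_mem h₂ h₁
  exact sub_eq_zero.1 (Submodule.disjoint_def.1 hdisj _ h₃
    (apply_sub_self_mem_moveSpan (v⁻¹ * w) x))

lemma eq_of_inInterval_of_moveSpan_eq (hp : w p = p) (hu : inInterval n w u)
    (hv : inInterval n w v) (h : moveSpan n u = moveSpan n v) : u = v := by
  have hle : moveSpan n (v⁻¹ * w) ≤ moveSpan n (u⁻¹ * w) :=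
    (moveSpan_le_moveSpan_iff (fixes_of_inInterval hp hv hp).2
      (fixes_of_inInterval hp hu hp).2).2 (fixSet_inv_mul_subset hp hv h)
  have hdisj : Disjoint (moveSpan n u) (moveSpan n (u⁻¹ * w)) :=
    disjoint_moveSpan (by rw [mul_inv_cancel_left, (inInterval_iff_moveDim hp).1 hu])
  have h₁ : moveSpan n (u⁻¹ * v) ≤ moveSpan n u := by
    refine (moveSpan_mul_le _ _).trans ?_
    rw [moveSpan_inv, h, sup_idem]
  have h₂ : moveSpan n (u⁻¹ * v) ≤ moveSpan n (u⁻¹ * w) := by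
    have h₃ := moveSpan_mul_le (u⁻¹ * w) (v⁻¹ * w)⁻¹
    rw [moveSpan_inv, mul_inv_rev, inv_inv, mul_assoc, mul_inv_cancel_left] at h₃
    exact h₃.trans (sup_le le_rfl hle)
  exact inv_mul_eq_one.1 (eq_one_of_moveSpan_le_bot (hdisj h₁ h₂))

lemma eq_of_inInterval_of_fixSet_eq (hp : w p = p) (hu : inInterval n w u)
    (hv : inInterval n w v) (h : FixSet n u = FixSet n v) : u = v := by
  have hup := (fixes_of_inInterval hp hu hp).1
  have hvp := (fixes_of_inInterval hp hv hp).1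
  exact eq_of_inInterval_of_moveSpan_eq hp hu hv
    (((moveSpan_le_moveSpan_iff hup hvp).2 h.ge).antisymm
      ((moveSpan_le_moveSpan_iff hvp hup).2 h.le))

lemma intervalLE_iff_inInterval (hv : inInterval n w v) :
    intervalLE n w u v ↔ inInterval n v u := by
  unfold intervalLE inInterval at *
  omega

end

/-- for `w` elliptic, the map `u ↦ Fix(u)` is an order-reversing
bijection from the interval `[1,w]` onto the set of affine subspaces of `E`
containing `Fix(w)`. -/
theorem elliptic_interval_fix_iso (n : ℕ) (w : Iso n)
    (hell : ∃ x : Euc n, w x = x) :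
    (∀ u, inInterval n w u →
        (∃ A : AffineSubspace ℝ (Euc n), (A : Set (Euc n)) = FixSet n u) ∧
        FixSet n w ⊆ FixSet n u) ∧
    (∀ A : AffineSubspace ℝ (Euc n), FixSet n w ⊆ (A : Set (Euc n)) →
        ∃ u, inInterval n w u ∧ FixSet n u = (A : Set (Euc n)) ∧
          ∀ u', inInterval n w u' → FixSet n u' = (A : Set (Euc n)) → u' = u) ∧
    (∀ u v, inInterval n w u → inInterval n w v →
        (intervalLE n w u v ↔ FixSet n v ⊆ FixSet n u)) := by
  obtain ⟨p, hp⟩ := hell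
  refine ⟨fun u hu => ?_, fun A hA => ?_, fun u v hu hv => ?_⟩
  · exact ⟨⟨_, (fixSet_eq_mk' (fixes_of_inInterval hp hu hp).1).symm⟩,
      fun x hx => (fixes_of_inInterval hp hu hx).1⟩
  · obtain ⟨u, hu, hfix⟩ := exists_inInterval_fixSet_eq hp hA
    exact ⟨u, hu, hfix, fun u' hu' hfix' =>
      eq_of_inInterval_of_fixSet_eq hp hu' hu (hfix'.trans hfix.symm)⟩
  · have hup := (fixes_of_inInterval hp hu hp).1
    have hvp := (fixes_of_inInterval hp hv hp).1
    rw [intervalLE_iff_inInterval hv]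
    constructor
    · exact fun h x hx => (fixes_of_inInterval hvp h hx).1
    · intro h
      rw [fixSet_eq_mk' hup] at h
      obtain ⟨u', hu', hfix⟩ := exists_inInterval_fixSet_eq hvp h
      rw [← fixSet_eq_mk' hup] at hfix
      rwa [← eq_of_inInterval_of_fixSet_eq hp (inInterval_trans hp hv hu') hu hfix]
end
end
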